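/- arXiv:2012.09506 — 5 statements merged into one kernel-verified Lean document; each statement's English description precedes it below -/
import Mathlib

section
/- Let k be a real number with |k| < 4. Then the logarithmic Mahler measure of k + (x+x⁻¹)(y+y⁻¹) can be written as a double integral: (2π)^{−2} ∫_{[0,2π]²} log|k + 4cos θ₁ cos θ₂| dθ₁dθ₂ = (|k|/(8π)) · ∫_{[0,1]²} dx₁ dx₂ / √(x₁ x₂ (1−x₂)(1 − x₁x₂k²/16)). -/
open MeasureTheory Real

/-- The function equal to `arcosh |p|` for `1 ≤ |p|` and to `0` for `|p| < 1`. -/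
noncomputable def truncArcosh (p : ℝ) : ℝ := log⁺ (|p| + √(p ^ 2 - 1))

theorem truncArcosh_nonneg (p : ℝ) : 0 ≤ truncArcosh p := posLog_nonneg

theorem measurable_truncArcosh : Measurable truncArcosh := by
  unfold truncArcosh
  simp only [Real.posLog]
  fun_prop

theorem truncArcosh_abs (p : ℝ) : truncArcosh |p| = truncArcosh p := by
  simp [truncArcosh]

theorem truncArcosh_of_abs_le_one {p : ℝ} (hp : |p| ≤ 1) : truncArcosh p = 0 := by
  have h : √(p ^ 2 - 1) = 0 := Real.sqrt_eq_zero_of_nonpos (by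
    have := sq_le_one_iff_abs_le_one p |>.2 hp
    linarith)
  rw [truncArcosh, h, add_zero, posLog_eq_zero_iff]
  simpa using hp

/-- The two roots of `z ^ 2 + 2 p z + 1` contribute `truncArcosh p` to the Mahler measure. -/
theorem exists_roots_posLog_norm (p : ℝ) : ∃ r s : ℂ, r + s = -(2 * p) ∧ r * s = 1 ∧
    log⁺ ‖r‖ + log⁺ ‖s‖ = truncArcosh p := by
  have key : ∀ u v : ℝ, 0 ≤ v → v ≤ u → u * v = 1 → log⁺ u + log⁺ v = log⁺ u := by
    intro u v hv huv h
    have : v ≤ 1 := by nlinarith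
    rw [(posLog_eq_zero_iff v).2 (by rwa [abs_of_nonneg hv]), add_zero]
  rcases le_total |p| 1 with h | h
  · have h0 : 0 ≤ 1 - p ^ 2 := by
      have := sq_le_one_iff_abs_le_one p |>.2 h
      linarith
    have hs : ((√(1 - p ^ 2) : ℝ) : ℂ) ^ 2 = 1 - p ^ 2 := by
      rw [← Complex.ofReal_pow, Real.sq_sqrt h0]; push_cast; ring
    have hn : ∀ w : ℝ, w ^ 2 = 1 - p ^ 2 → ‖(-p + w * Complex.I : ℂ)‖ = 1 := by
      intro w hw
      have := Complex.norm_add_mul_I (-p) w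
      push_cast at this
      rw [this, hw]; simp
    refine ⟨-p + √(1 - p ^ 2) * Complex.I, -p + (-√(1 - p ^ 2) : ℝ) * Complex.I, ?_, ?_, ?_⟩
    · push_cast; ring
    · push_cast
      linear_combination (-(√(1 - p ^ 2) : ℂ) ^ 2) * Complex.I_sq + hs
    · rw [hn _ (Real.sq_sqrt h0), hn _ (by rw [neg_sq, Real.sq_sqrt h0]),
        truncArcosh_of_abs_le_one h]
      simp
  · have h0 : 0 ≤ p ^ 2 - 1 := by
      have := one_le_sq_iff_one_le_abs p |>.2 h
      linarith
    have hs := Real.sq_sqrt h0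
    have hsn := Real.sqrt_nonneg (p ^ 2 - 1)
    set w := √(p ^ 2 - 1) with hw
    have hle : w ≤ |p| := abs_le_of_sq_le_sq' (by rw [sq_abs]; linarith) (abs_nonneg p) |>.2
    have hT : truncArcosh p = log⁺ (|p| + w) := rfl
    rcases le_total 0 p with hp | hp
    · rw [abs_of_nonneg hp] at hle hT
      refine ⟨(-(p + w) : ℝ), (-(p - w) : ℝ), ?_, ?_, ?_⟩
      · push_cast; ring
      · rw [← Complex.ofReal_mul]; norm_cast; linarith
      · rw [Complex.norm_real, Complex.norm_real, norm_neg, norm_neg, Real.norm_eq_abs,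
          Real.norm_eq_abs, abs_of_nonneg (by linarith), abs_of_nonneg (by linarith), hT]
        exact key _ _ (by linarith) (by linarith) (by linarith)
    · rw [abs_of_nonpos hp] at hle hT
      refine ⟨(-p + w : ℝ), (-p - w : ℝ), ?_, ?_, ?_⟩
      · push_cast; ring
      · rw [← Complex.ofReal_mul]; norm_cast; linarith
      · rw [Complex.norm_real, Complex.norm_real, Real.norm_eq_abs,
          Real.norm_eq_abs, abs_of_nonneg (by linarith), abs_of_nonneg (by linarith), hT]
        exact key _ _ (by linarith) (by linarith) (by linarith)

open Polynomial in
theorem log_abs_add_mul_cos_integral (a : ℝ) {b : ℝ} (hb : b ≠ 0) :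
    IntervalIntegrable (fun θ => log |a + b * cos θ|) volume 0 (2 * π) ∧
    ∫ θ in 0..2 * π, log |a + b * cos θ| = 2 * π * (log (|b| / 2) + truncArcosh (a / b)) := by
  obtain ⟨r, s, hadd, hmul, hlog⟩ := exists_roots_posLog_norm (a / b)
  set P : ℂ[X] := C ((b / 2 : ℝ) : ℂ) * ((X - C r) * (X - C s)) with hP
  have hprod : (X - C r) * (X - C s) ≠ 0 := mul_ne_zero (X_sub_C_ne_zero r) (X_sub_C_ne_zero s)
  have hb2 : ((b / 2 : ℝ) : ℂ) ≠ 0 := by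
    rw [Complex.ofReal_ne_zero]; exact div_ne_zero hb two_ne_zero
  have hbC : (b : ℂ) ≠ 0 := Complex.ofReal_ne_zero.2 hb
  have heval : ∀ θ : ℝ, log ‖P.eval (circleMap 0 1 θ)‖ = log |a + b * cos θ| := by
    intro θ
    have hz : P.eval (circleMap 0 1 θ) = circleMap 0 1 θ * ((a + b * cos θ : ℝ) : ℂ) := by
      have hc : circleMap 0 1 θ = Complex.exp (θ * Complex.I) := by simp [circleMap]
      have hcos : (2 : ℂ) * Complex.cos θ = Complex.exp (θ * Complex.I)
          + Complex.exp (-(θ * Complex.I)) := by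
        rw [Complex.two_cos]; ring_nf
      have hinv : Complex.exp (θ * Complex.I) * Complex.exp (-(θ * Complex.I)) = 1 := by
        rw [← Complex.exp_add]; simp
      have hab : (b : ℂ) * (r + s) = - (2 * a) := by
        rw [hadd]; push_cast; field_simp
      simp only [hP, hc, eval_mul, eval_C, eval_sub, eval_X]
      push_cast
      set z := Complex.exp (θ * Complex.I)
      linear_combination (-z / 2) * hab + (b / 2 : ℂ) * hmul - (b / 2 * z) * hcos
        - (b / 2 : ℂ) * hinv
    rw [hz, norm_mul, norm_circleMap_zero, abs_one, one_mul, Complex.norm_real, Real.norm_eq_abs]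
  constructor
  · simpa only [heval] using intervalIntegrable_mahlerMeasure P
  · have h1 : P.logMahlerMeasure = log (|b| / 2) + truncArcosh (a / b) := by
      rw [hP, logMahlerMeasure_C_mul hb2 hprod, logMahlerMeasure_mul_eq_add_logMahlerMeasure hprod,
        logMahlerMeasure_X_sub_C, logMahlerMeasure_X_sub_C, hlog, Complex.norm_real,
        Real.norm_eq_abs, abs_div, abs_two]
    rw [← h1, logMahlerMeasure_def, circleAverage_def]
    simp only [heval, smul_eq_mul]
    rw [mul_inv_cancel_left₀ (by positivity)]

theorem lintegral_Ioc_ofReal_deriv {f f' : ℝ → ℝ} {a b : ℝ} (hab : a ≤ b)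
    (hcont : ContinuousOn f (Set.Icc a b)) (hderiv : ∀ x ∈ Set.Ioo a b, HasDerivAt f (f' x) x)
    (hpos : ∀ x ∈ Set.Ioo a b, 0 ≤ f' x) :
    ∫⁻ x in Set.Ioc a b, ENNReal.ofReal (f' x) = ENNReal.ofReal (f b - f a) := by
  have hint := intervalIntegral.integrableOn_deriv_of_nonneg hcont hderiv hpos
  rw [← intervalIntegral.integral_eq_sub_of_hasDerivAt_of_le hab hcont hderiv
    ((intervalIntegrable_iff_integrableOn_Ioc_of_le hab).2 hint),
    intervalIntegral.integral_of_le hab, ofReal_integral_eq_lintegral_ofReal hint]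
  rw [← restrict_Ioo_eq_restrict_Ioc]
  exact (ae_restrict_iff' measurableSet_Ioo).2 (.of_forall hpos)

theorem lintegral_Ioc_inv_mul_sqrt_one_sub {s : ℝ} (hs : 0 < s) (hs1 : s ≤ 1) :
    ∫⁻ x in Set.Ioc s 1, ENNReal.ofReal (1 / (x * √(1 - x))) =
      ENNReal.ofReal (2 * truncArcosh (√s)⁻¹) := by
  have hq : 0 < √s := Real.sqrt_pos.2 hs
  have hT : 2 * truncArcosh (√s)⁻¹ = (fun x => log x - 2 * log (1 + √(1 - x))) 1
      - (fun x => log x - 2 * log (1 + √(1 - x))) s := by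
    have h1 : (√s)⁻¹ ^ 2 - 1 = (1 - s) / s := by
      rw [inv_pow, Real.sq_sqrt hs.le]; field_simp
    have h2 : |(√s)⁻¹| + √((√s)⁻¹ ^ 2 - 1) = (1 + √(1 - s)) / √s := by
      rw [h1, Real.sqrt_div (by linarith), abs_of_pos (by positivity)]; field_simp
    have h3 : (1 : ℝ) ≤ (1 + √(1 - s)) / √s := by
      rw [one_le_div hq]
      have := Real.sqrt_le_one.2 hs1
      have := Real.sqrt_nonneg (1 - s)
      linarith
    rw [truncArcosh, h2, posLog_eq_log (h3.trans (le_abs_self _)),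
      Real.log_div (by positivity) hq.ne', Real.log_sqrt hs.le]
    simp
    ring
  rw [hT]
  refine lintegral_Ioc_ofReal_deriv (f := fun x => log x - 2 * log (1 + √(1 - x)))
    (f' := fun x => 1 / (x * √(1 - x))) hs1 ?_ ?_ ?_
  · refine ContinuousOn.sub (continuousOn_id.log fun x hx => (hs.trans_le hx.1).ne') ?_
    refine continuousOn_const.mul (ContinuousOn.log (by fun_prop) fun x _ => by positivity)
  · intro x hx
    have hx0 : 0 < x := hs.trans hx.1
    have hx1 : 0 < 1 - x := by linarith [hx.2]
    have hw : 0 < √(1 - x) := Real.sqrt_pos.2 hx1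
    have hw2 := Real.sq_sqrt hx1.le
    have hd := (Real.hasDerivAt_log hx0.ne').sub
      ((((((hasDerivAt_id x).const_sub 1).sqrt hx1.ne').const_add 1).log
        (by positivity)).const_mul 2)
    refine hd.congr_deriv ?_
    simp only [id]
    set w := √(1 - x)
    field_simp
    linear_combination hw2
  · intro x hx
    have : 0 < x := hs.trans hx.1
    positivity

theorem lintegral_Ioc_inv_sqrt {κ x : ℝ} (hκ : 0 < κ) (hκ1 : κ < 1) (hx0 : 0 < x) (hx1 : x < 1) :
    ∫⁻ t in Set.Ioc 0 1, ENNReal.ofReal (1 / √(t * x * (1 - x) * (1 - t * x * κ ^ 2))) =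
      ENNReal.ofReal (2 / κ * (1 / (x * √(1 - x)))) * ENNReal.ofReal (arcsin (κ * √x)) := by
  have hy : 0 < 1 - x := by linarith
  have hs := Real.sqrt_pos.2 hy
  rw [← ENNReal.ofReal_mul (by positivity)]
  have := lintegral_Ioc_ofReal_deriv (a := 0) (b := 1)
    (f := fun t => 2 / κ * (1 / (x * √(1 - x))) * arcsin (κ * √(t * x)))
    (f' := fun t => 1 / √(t * x * (1 - x) * (1 - t * x * κ ^ 2))) zero_le_one ?_ ?_ ?_
  · rw [this]; simp
  · refine Continuous.continuousOn (continuous_const.mul (continuous_arcsin.comp (by fun_prop)))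
  · intro t ht
    have htx : 0 < t * x := mul_pos ht.1 hx0
    have htx1 : t * x < 1 := by nlinarith [ht.2]
    have hw := Real.sqrt_pos.2 htx
    have hw2 := Real.sq_sqrt htx.le
    have hlt : (κ * √(t * x)) ^ 2 < 1 := by
      rw [mul_pow, hw2]
      nlinarith [mul_lt_mul'' hκ1 hκ1 hκ.le hκ.le]
    have habs := abs_lt.1 (sq_lt_one_iff_abs_lt_one _ |>.1 hlt)
    have h1 : 0 < 1 - t * x * κ ^ 2 := by rw [mul_pow, hw2] at hlt; linarith
    have hd := (((Real.hasDerivAt_arcsin habs.1.ne' habs.2.ne).comp t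
      ((((hasDerivAt_id t).mul_const x).sqrt htx.ne').const_mul κ)).const_mul
        (2 / κ * (1 / (x * √(1 - x)))))
    refine hd.congr_deriv ?_
    rw [Real.sqrt_mul (mul_pos htx hy).le, Real.sqrt_mul htx.le, mul_pow]
    simp only [id, hw2]
    rw [show 1 - κ ^ 2 * (t * x) = 1 - t * x * κ ^ 2 by ring]
    have := Real.sqrt_pos.2 h1
    set w := √(t * x)
    field_simp
  · intro t _
    positivity

theorem lintegral_lintegral_inv_sqrt {κ : ℝ} (hκ : 0 < κ) (hκ1 : κ < 1) :
    ∫⁻ x in Set.Ioc 0 1, ∫⁻ t in Set.Ioc 0 1,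
        ENNReal.ofReal (1 / √(t * x * (1 - x) * (1 - t * x * κ ^ 2))) =
      ENNReal.ofReal (4 / κ) *
        ∫⁻ θ in Set.Ioo 0 (π / 2), ENNReal.ofReal (truncArcosh (κ / sin θ)) := by
  set c : ℝ → ENNReal := fun x => ENNReal.ofReal (2 / κ * (1 / (x * √(1 - x)))) with hc
  have hcm : Measurable c := by fun_prop
  set A : Set (ℝ × ℝ) := {p | sin p.2 < κ * √p.1} with hA
  have hAm : MeasurableSet A := measurableSet_lt (by fun_prop) (by fun_prop)
  have hgm : Measurable (A.indicator fun p => c p.1) := (hcm.comp measurable_fst).indicator hAm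
  have hinner : ∀ x ∈ Set.Ioo (0 : ℝ) 1,
      ∫⁻ t in Set.Ioc 0 1, ENNReal.ofReal (1 / √(t * x * (1 - x) * (1 - t * x * κ ^ 2))) =
        ∫⁻ θ in Set.Ioo 0 (π / 2), A.indicator (fun p => c p.1) (x, θ) := by
    intro x hx
    have hy0 : 0 < κ * √x := mul_pos hκ (Real.sqrt_pos.2 hx.1)
    have hy1 : κ * √x < 1 := by
      have := Real.sqrt_le_one.2 hx.2.le
      nlinarith
    have hset : (fun θ => A.indicator (fun p => c p.1) (x, θ)) =
        {θ | sin θ < κ * √x}.indicator fun _ => c x := by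
      ext θ; simp [Set.indicator, hA]
    have hinter : {θ | sin θ < κ * √x} ∩ Set.Ioo 0 (π / 2) = Set.Ioo 0 (arcsin (κ * √x)) := by
      ext θ
      constructor
      · rintro ⟨h, h0, h1⟩
        exact ⟨h0, (lt_arcsin_iff_sin_lt ⟨by linarith, h1.le⟩ ⟨by linarith, hy1.le⟩).2 h⟩
      · rintro ⟨h0, h1⟩
        have h2 := h1.trans_le (arcsin_le_pi_div_two _)
        exact ⟨(lt_arcsin_iff_sin_lt ⟨by linarith, h2.le⟩ ⟨by linarith, hy1.le⟩).1 h1, h0, h2⟩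
    have hm : MeasurableSet {θ | sin θ < κ * √x} :=
      measurableSet_lt (by fun_prop) (by fun_prop)
    rw [lintegral_Ioc_inv_sqrt hκ hκ1 hx.1 hx.2, hset, lintegral_indicator_const hm,
      Measure.restrict_apply hm, hinter, Real.volume_Ioo, sub_zero]
  have houter : ∀ θ ∈ Set.Ioo (0 : ℝ) (π / 2),
      ∫⁻ x in Set.Ioo 0 1, A.indicator (fun p => c p.1) (x, θ) =
        ENNReal.ofReal (4 / κ) * ENNReal.ofReal (truncArcosh (κ / sin θ)) := by
    intro θ hθ
    have hsin : 0 < sin θ := sin_pos_of_pos_of_lt_pi hθ.1 (by linarith [hθ.2, pi_pos])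
    have hset : (fun x => A.indicator (fun p => c p.1) (x, θ)) =
        {x | sin θ < κ * √x}.indicator c := by
      ext x; simp [Set.indicator, hA]
    have hm : MeasurableSet {x | sin θ < κ * √x} :=
      measurableSet_lt (by fun_prop) (by fun_prop)
    have hinter : {x | sin θ < κ * √x} ∩ Set.Ioo 0 1 = Set.Ioo ((sin θ / κ) ^ 2) 1 := by
      ext x
      have : sin θ < κ * √x ↔ (sin θ / κ) ^ 2 < x := by
        rw [← Real.lt_sqrt (by positivity), div_lt_iff₀' hκ]
      have h0 : 0 ≤ (sin θ / κ) ^ 2 := by positivity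
      simp only [Set.mem_inter_iff, Set.mem_ofPred_eq, this, Set.mem_Ioo]
      exact ⟨fun h => ⟨h.1, h.2.2⟩, fun h => ⟨h.1, h0.trans_lt h.1, h.2⟩⟩
    rw [hset, setLIntegral_indicator hm, hinter, restrict_Ioo_eq_restrict_Ioc]
    rcases le_total (sin θ / κ) 1 with h | h
    · simp_rw [hc, ENNReal.ofReal_mul (div_nonneg zero_le_two hκ.le)]
      rw [lintegral_const_mul _ (by fun_prop),
        lintegral_Ioc_inv_mul_sqrt_one_sub (by positivity)
          (pow_le_one₀ (by positivity) h), Real.sqrt_sq (by positivity), inv_div,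
        ← ENNReal.ofReal_mul (by positivity), ← ENNReal.ofReal_mul (by positivity)]
      congr 1
      ring
    · rw [Set.Ioc_eq_empty (not_lt.2 (one_le_pow₀ h)),
        truncArcosh_of_abs_le_one (by
          rw [abs_of_pos (by positivity), div_le_one hsin]; rwa [one_le_div hκ] at h)]
      simp
  rw [← setLIntegral_congr (Ioo_ae_eq_Ioc (a := (0 : ℝ)) (b := 1)),
    setLIntegral_congr_fun measurableSet_Ioo hinner,
    lintegral_lintegral_swap (f := fun x θ => A.indicator (fun p => c p.1) (x, θ))
      hgm.aemeasurable,
    setLIntegral_congr_fun measurableSet_Ioo houter,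
    lintegral_const_mul' _ _ ENNReal.ofReal_ne_top]

theorem setIntegral_pi_Icc_fin_two (f : ℝ → ℝ → ℝ) (a b : ℝ) :
    ∫ x : Fin 2 → ℝ in Set.univ.pi fun _ => Set.Icc a b, f (x 0) (x 1) =
      ∫ z, f z.1 z.2 ∂((volume.restrict (Set.Ioc a b)).prod (volume.restrict (Set.Ioc a b))) := by
  have h := (volume_preserving_finTwoArrow ℝ).setIntegral_preimage_emb
    MeasurableEquiv.finTwoArrow.measurableEmbedding (fun z => f z.1 z.2)
    (Set.Icc a b ×ˢ Set.Icc a b)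
  have hset : (Set.univ.pi fun _ : Fin 2 => Set.Icc a b) =
      MeasurableEquiv.finTwoArrow ⁻¹' (Set.Icc a b ×ˢ Set.Icc a b) := by
    ext x
    simp only [Set.mem_univ_pi, Fin.forall_fin_two]
    rfl
  rw [restrict_Ioc_eq_restrict_Icc, Measure.prod_restrict, hset]
  exact h

theorem integral_comp_abs_cos {g : ℝ → ℝ}
    (hg : IntervalIntegrable (fun θ => g |cos θ|) volume 0 (2 * π)) :
    ∫ θ in 0..2 * π, g |cos θ| = 4 * ∫ θ in 0..π / 2, g (sin θ) := by
  have hpi := pi_pos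
  have hsub : ∀ a b, a ∈ Set.Icc 0 (2 * π) → b ∈ Set.Icc 0 (2 * π) →
      IntervalIntegrable (fun θ => g |cos θ|) volume a b := fun a b ha hb =>
    hg.mono_set (by
      rw [Set.uIcc_of_le (a := 0) (by positivity)]
      exact Set.uIcc_subset_Icc ha hb)
  have h1 : ∫ θ in 0..π / 2, g |cos θ| = ∫ θ in 0..π / 2, g (sin θ) := by
    have := intervalIntegral.integral_comp_sub_left (a := 0) (b := π / 2)
      (fun θ => g |cos θ|) (π / 2)
    simp only [sub_self, sub_zero, cos_pi_div_two_sub] at this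
    rw [← this]
    refine intervalIntegral.integral_congr fun θ hθ => ?_
    rw [Set.uIcc_of_le (by positivity)] at hθ
    rw [abs_of_nonneg (sin_nonneg_of_nonneg_of_le_pi hθ.1 (by linarith [hθ.2]))]
  have h2 : ∫ θ in π / 2..π, g |cos θ| = ∫ θ in 0..π / 2, g |cos θ| := by
    have := intervalIntegral.integral_comp_sub_left (a := 0) (b := π / 2)
      (fun θ => g |cos θ|) π
    simp only [cos_pi_sub, abs_neg, sub_zero] at this
    rw [this]
    congr 1
    ring
  have h3 : ∫ θ in π..2 * π, g |cos θ| = ∫ θ in 0..π, g |cos θ| := by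
    have := intervalIntegral.integral_comp_add_right (a := 0) (b := π)
      (fun θ => g |cos θ|) π
    simp only [cos_add_pi, abs_neg, zero_add] at this
    rw [this]
    congr 1
    ring
  rw [← intervalIntegral.integral_add_adjacent_intervals
      (hsub 0 π ⟨le_rfl, by linarith⟩ ⟨by linarith, by linarith⟩)
      (hsub π (2 * π) ⟨by linarith, by linarith⟩ ⟨by linarith, by linarith⟩), h3,
    ← intervalIntegral.integral_add_adjacent_intervals
      (hsub 0 (π / 2) ⟨le_rfl, by linarith⟩ ⟨by linarith, by linarith⟩)
      (hsub (π / 2) π ⟨by linarith, by linarith⟩ ⟨by linarith, by linarith⟩), h2, h1]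
  ring

theorem log_abs_cos_integral :
    IntervalIntegrable (fun θ => log (2 * |cos θ|)) volume 0 (2 * π) ∧
      ∫ θ in 0..2 * π, log (2 * |cos θ|) = 0 := by
  have h := log_abs_add_mul_cos_integral 0 (two_ne_zero (α := ℝ))
  have hfun : (fun θ => log |0 + 2 * cos θ|) = fun θ => log (2 * |cos θ|) := by
    ext θ; rw [zero_add, abs_mul, abs_two]
  rw [hfun] at h
  refine ⟨h.1, h.2.trans ?_⟩
  rw [truncArcosh_of_abs_le_one (by simp)]
  simp

theorem ae_cos_ne_zero : ∀ᵐ θ : ℝ, cos θ ≠ 0 := by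
  have : {θ : ℝ | cos θ = 0}.Countable := by
    refine (Set.countable_range fun n : ℤ => (2 * (n : ℝ) + 1) * π / 2).mono fun θ hθ => ?_
    obtain ⟨n, hn⟩ := cos_eq_zero_iff.1 hθ
    exact ⟨n, hn.symm⟩
  exact this.ae_notMem volume

theorem log_abs_add_cos_mul_cos_integral {k : ℝ} (hk : |k| < 4) :
    IntervalIntegrable (fun θ => truncArcosh (|k| / 4 / |cos θ|)) volume 0 (2 * π) ∧
    ∫ z, log |k + 4 * cos z.1 * cos z.2| ∂((volume.restrict (Set.Ioc 0 (2 * π))).prod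
        (volume.restrict (Set.Ioc 0 (2 * π)))) =
      2 * π * ∫ θ in 0..2 * π, truncArcosh (|k| / 4 / |cos θ|) := by
  have h2pi : 0 ≤ 2 * π := by positivity
  set μ : Measure ℝ := volume.restrict (Set.Ioc 0 (2 * π)) with hμ
  set L : ℝ × ℝ → ℝ := fun z => log |k + 4 * cos z.1 * cos z.2| with hL
  have hLm : Measurable L := by fun_prop
  have hsec : ∀ y, cos y ≠ 0 → Integrable (fun x => L (x, y)) μ ∧
      ∫ x, L (x, y) ∂μ = 2 * π * (log (2 * |cos y|) + truncArcosh (|k| / 4 / |cos y|)) := by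
    intro y hy
    have h := log_abs_add_mul_cos_integral k (mul_ne_zero (four_ne_zero (α := ℝ)) hy)
    have hfun : (fun x => log |k + 4 * cos y * cos x|) = fun x => L (x, y) := by
      ext x; simp only [hL]; congr 2; ring
    rw [hfun, intervalIntegrable_iff_integrableOn_Ioc_of_le h2pi,
      intervalIntegral.integral_of_le h2pi, ← truncArcosh_abs] at h
    refine ⟨h.1, h.2.trans ?_⟩
    rw [abs_div, abs_mul, abs_of_pos (four_pos (α := ℝ)), div_div]
    congr 3
    ring
  have hae : ∀ᵐ y ∂μ, cos y ≠ 0 := ae_restrict_of_ae ae_cos_ne_zero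
  obtain ⟨hci, hc0⟩ := log_abs_cos_integral
  rw [intervalIntegrable_iff_integrableOn_Ioc_of_le h2pi] at hci
  have hLle : ∀ z, L z ≤ log 8 := by
    intro z
    have h1 : |k + 4 * cos z.1 * cos z.2| ≤ 8 := by
      have := abs_add_le k (4 * cos z.1 * cos z.2)
      have h2 : |4 * cos z.1 * cos z.2| ≤ 4 := by
        rw [abs_mul, abs_mul, abs_of_pos (four_pos (α := ℝ))]
        nlinarith [abs_cos_le_one z.1, abs_cos_le_one z.2, abs_nonneg (cos z.1),
          abs_nonneg (cos z.2)]
      linarith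
    rcases (abs_nonneg (k + 4 * cos z.1 * cos z.2)).eq_or_lt with h0 | h0
    · simp only [hL, ← h0, log_zero]
      exact log_nonneg (by norm_num)
    · exact log_le_log h0 h1
  have hlog8 : 0 ≤ log 8 := log_nonneg (by norm_num)
  have hLi : Integrable L (μ.prod μ) := by
    rw [integrable_prod_iff' hLm.aestronglyMeasurable]
    refine ⟨hae.mono fun y hy => (hsec y hy).1, ?_⟩
    refine Integrable.mono' (g := fun y => 2 * π * (2 * log 8) + 2 * π * |log (2 * |cos y|)|)
      ((integrable_const _).add (hci.abs.const_mul _)) ?_ ?_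
    · exact (hLm.norm.stronglyMeasurable.integral_prod_left').aestronglyMeasurable
    · filter_upwards [hae] with y hy
      obtain ⟨hi, he⟩ := hsec y hy
      rw [Real.norm_of_nonneg (integral_nonneg fun _ => norm_nonneg _)]
      calc ∫ x, ‖L (x, y)‖ ∂μ ≤ ∫ x, (2 * log 8 - L (x, y)) ∂μ := by
            refine integral_mono hi.norm ((integrable_const _).sub hi) fun x => ?_
            simp only [Real.norm_eq_abs]
            rw [abs_le]
            constructor <;> linarith [hLle (x, y)]
        _ = 2 * π * (2 * log 8) -
            2 * π * (log (2 * |cos y|) + truncArcosh (|k| / 4 / |cos y|)) := by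
            rw [integral_sub (integrable_const _) hi, he, integral_const]
            simp [hμ, Measure.real, pi_pos.le]
        _ ≤ _ := by
            have h1 := truncArcosh_nonneg (|k| / 4 / |cos y|)
            have h2 := neg_abs_le (log (2 * |cos y|))
            nlinarith [pi_pos]
  have hsecae : (fun y => ∫ x, L (x, y) ∂μ) =ᵐ[μ]
      fun y => 2 * π * (log (2 * |cos y|) + truncArcosh (|k| / 4 / |cos y|)) :=
    hae.mono fun y hy => (hsec y hy).2
  have hTi : Integrable (fun y => truncArcosh (|k| / 4 / |cos y|)) μ := by
    have := ((hLi.integral_prod_right.congr hsecae).const_mul (2 * π)⁻¹).sub hci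
    refine this.congr (.of_forall fun y => ?_)
    simp only [Pi.sub_apply]
    rw [inv_mul_cancel_left₀ (by positivity)]
    ring
  refine ⟨(intervalIntegrable_iff_integrableOn_Ioc_of_le h2pi).2 hTi, ?_⟩
  rw [integral_prod_symm _ hLi, integral_congr_ae hsecae, integral_const_mul,
    integral_add hci hTi, intervalIntegral.integral_of_le h2pi]
  rw [intervalIntegral.integral_of_le h2pi] at hc0
  rw [hc0, zero_add]

/-- For `|k| < 4`, the logarithmic Mahler measure of `k + (x+x⁻¹)(y+y⁻¹)` as a
double integral:
`(2π)⁻² ∫ log|k + 4 cos θ₁ cos θ₂|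
  = (|k|/(8π)) ∫_{[0,1]²} dx₁dx₂ / √(x₁x₂(1−x₂)(1−x₁x₂k²/16))`. -/
theorem stmt10 (k : ℝ) (hk : |k| < 4) :
    ((2 * π) ^ 2)⁻¹ *
        (∫ θ : Fin 2 → ℝ in Set.univ.pi fun _ => Set.Icc 0 (2 * π),
          Real.log |k + 4 * Real.cos (θ 0) * Real.cos (θ 1)|) =
      |k| / (8 * π) *
        ∫ x : Fin 2 → ℝ in Set.univ.pi fun _ => Set.Icc 0 1,
          1 / Real.sqrt (x 0 * x 1 * (1 - x 1) * (1 - x 0 * x 1 * k ^ 2 / 16)) := by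
  have hint : ∀ f : ℝ × ℝ → ℝ, Measurable f → (∀ z, 0 ≤ f z) →
      ∫ z, f z ∂((volume.restrict (Set.Ioc 0 1)).prod (volume.restrict (Set.Ioc 0 1))) =
        (∫⁻ y in Set.Ioc (0 : ℝ) 1, ∫⁻ x in Set.Ioc (0 : ℝ) 1,
          ENNReal.ofReal (f (x, y))).toReal := by
    intro f hf h0
    rw [integral_eq_lintegral_of_nonneg_ae (.of_forall h0) hf.aestronglyMeasurable,
      lintegral_prod_symm' _ (by fun_prop)]
  obtain ⟨hTi, hI⟩ := log_abs_add_cos_mul_cos_integral hk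
  rw [setIntegral_pi_Icc_fin_two (fun x y => log |k + 4 * cos x * cos y|), hI,
    integral_comp_abs_cos (g := fun u => truncArcosh (|k| / 4 / u)) hTi,
    setIntegral_pi_Icc_fin_two
      (fun x y => 1 / √(x * y * (1 - y) * (1 - x * y * k ^ 2 / 16))),
    hint _ (by fun_prop) fun z => by positivity]
  rcases eq_or_ne k 0 with rfl | hk0
  · simp [truncArcosh_of_abs_le_one]
  have hκ : 0 < |k| / 4 := by positivity
  have hker : ∀ x y : ℝ, x * y * k ^ 2 / 16 = x * y * (|k| / 4) ^ 2 := by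
    intro x y; rw [div_pow, sq_abs]; ring
  simp only [hker]
  rw [lintegral_lintegral_inv_sqrt hκ (by linarith), ENNReal.toReal_mul,
    ENNReal.toReal_ofReal (by positivity), intervalIntegral.integral_of_le (by positivity),
    ← restrict_Ioo_eq_restrict_Ioc,
    integral_eq_lintegral_of_nonneg_ae (.of_forall fun _ => truncArcosh_nonneg _)
      (measurable_truncArcosh.comp (by fun_prop)).aestronglyMeasurable]
  have := pi_pos
  field_simp
  ring
end

section
/- Let k be a real number with 0 < |k| < 8. Then the logarithmic Mahler measure of k + (x+x⁻¹)(y+y⁻¹)(z+z⁻¹) can be written as a triple integral: (2π)^{−3} ∫_{[0,2π]³} log|k + 8cos θ₁ cos θ₂ cos θ₃| dθ₁dθ₂dθ₃ = (|k|/(16π²)) · ∫_{[0,1]³} dx₁ dx₂ dx₃ / √(x₁ x₂ x₃ (1−x₁)(1−x₂)(1 − x₁ + (k²/64) x₁x₂x₃)). -/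
open MeasureTheory Real

/-- The function `x ↦ x ^ (-1/2)` on `(0, ∞)`, extended by zero, with values in `ℝ≥0∞`. -/
noncomputable def invSqrt (x : ℝ) : ENNReal := ENNReal.ofReal (√x)⁻¹

lemma invSqrt_of_nonpos {x : ℝ} (hx : x ≤ 0) : invSqrt x = 0 := by
  simp [invSqrt, Real.sqrt_eq_zero_of_nonpos hx]

lemma invSqrt_mul {x : ℝ} (hx : 0 ≤ x) (y : ℝ) : invSqrt (x * y) = invSqrt x * invSqrt y := by
  rw [invSqrt, Real.sqrt_mul hx, mul_inv, ENNReal.ofReal_mul (by positivity), invSqrt, invSqrt]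

lemma invSqrt_mul_self {x : ℝ} (hx : 0 ≤ x) : invSqrt (x * x) = ENNReal.ofReal x⁻¹ := by
  rw [invSqrt, Real.sqrt_mul_self hx]

lemma ofReal_mul_invSqrt_mul_self {x : ℝ} (hx : 0 < x) :
    ENNReal.ofReal x * (invSqrt x * invSqrt x) = 1 := by
  rw [← invSqrt_mul hx.le, invSqrt_mul_self hx.le, ← ENNReal.ofReal_mul hx.le,
    mul_inv_cancel₀ hx.ne', ENNReal.ofReal_one]

@[fun_prop]
lemma measurable_invSqrt : Measurable invSqrt := by
  unfold invSqrt
  fun_prop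

lemma invSqrt_mul_invSqrt_one_sub_eq_zero {x : ℝ} (hx : x ∉ Set.Ioo (0 : ℝ) 1) :
    invSqrt x * invSqrt (1 - x) = 0 := by
  rcases le_or_gt x 0 with h | h
  · rw [invSqrt_of_nonpos h, zero_mul]
  · have : 1 ≤ x := not_lt.1 fun h' => hx ⟨h, h'⟩
    rw [invSqrt_of_nonpos (x := 1 - x) (by linarith), mul_zero]

lemma lintegral_comp_mul_add (f : ℝ → ENNReal) {c : ℝ} (hc : c ≠ 0) (d : ℝ) :
    ∫⁻ x, f x = ∫⁻ x, ENNReal.ofReal |c| * f (c * x + d) := by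
  have hsurj : (fun x : ℝ => c * x + d) '' Set.univ = Set.univ := by
    rw [Set.image_univ, Set.range_eq_univ]
    intro y
    exact ⟨(y - d) / c, by field_simp; ring⟩
  have h := lintegral_image_eq_lintegral_abs_deriv_mul (s := Set.univ)
    (f := fun x : ℝ => c * x + d) (f' := fun _ => c) MeasurableSet.univ
    (fun x _ => by
      simpa using (((hasDerivAt_id' x).const_mul c).add_const d).hasDerivWithinAt (s := Set.univ))
    (fun x _ y _ hxy => by simpa [hc] using hxy) f
  rw [hsurj] at h
  simpa using h

/-- The arcsine law: change of variables `v = cos² θ` on a quarter period. -/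
lemma lintegral_invSqrt_mul_eq_lintegral_cos_sq (h : ℝ → ENNReal) :
    ∫⁻ v, invSqrt v * invSqrt (1 - v) * h v =
      2 * ∫⁻ t in Set.Ioo 0 (π / 2), h (cos t ^ 2) := by
  have himg : (fun t => cos t ^ 2) '' Set.Ioo 0 (π / 2) = Set.Ioo (0 : ℝ) 1 := by
    ext v
    constructor
    · rintro ⟨t, ⟨h0, h1⟩, rfl⟩
      have hc : 0 < cos t := cos_pos_of_mem_Ioo ⟨by linarith, h1⟩
      have hs : 0 < sin t := sin_pos_of_mem_Ioo ⟨h0, by linarith [pi_pos]⟩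
      exact ⟨by positivity, by nlinarith [sin_sq_add_cos_sq t]⟩
    · rintro ⟨h0, h1⟩
      have h2 : 0 < √v := Real.sqrt_pos.2 h0
      have h3 : √v < 1 := by rw [Real.sqrt_lt' one_pos]; simpa using h1
      refine ⟨arccos √v, ⟨arccos_pos.2 h3, arccos_lt_pi_div_two.2 h2⟩, ?_⟩
      simp only
      rw [cos_arccos (by linarith) h3.le, Real.sq_sqrt h0.le]
  have hinj : Set.InjOn (fun t => cos t ^ 2) (Set.Ioo 0 (π / 2)) := by
    intro s hs t ht hst
    have hs' : 0 < cos s := cos_pos_of_mem_Ioo ⟨by linarith [hs.1, pi_pos], hs.2⟩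
    have ht' : 0 < cos t := cos_pos_of_mem_Ioo ⟨by linarith [ht.1, pi_pos], ht.2⟩
    have : cos s = cos t := (pow_left_inj₀ hs'.le ht'.le two_ne_zero).1 hst
    exact injOn_cos ⟨hs.1.le, by linarith [hs.2, pi_pos]⟩ ⟨ht.1.le, by linarith [ht.2, pi_pos]⟩ this
  have key := lintegral_image_eq_lintegral_abs_deriv_mul (s := Set.Ioo 0 (π / 2))
    (f := fun t => cos t ^ 2) (f' := fun t => 2 * cos t * (- sin t)) measurableSet_Ioo
    (fun t _ => by simpa using ((hasDerivAt_cos t).fun_pow 2).hasDerivWithinAt) hinj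
    (fun v => invSqrt v * invSqrt (1 - v) * h v)
  rw [himg] at key
  have hsupp : ∫⁻ v, invSqrt v * invSqrt (1 - v) * h v =
      ∫⁻ v in Set.Ioo (0 : ℝ) 1, invSqrt v * invSqrt (1 - v) * h v := by
    rw [← lintegral_indicator measurableSet_Ioo]
    congr 1 with v
    by_cases hv : v ∈ Set.Ioo (0 : ℝ) 1
    · simp [hv]
    · rw [Set.indicator_of_notMem hv, invSqrt_mul_invSqrt_one_sub_eq_zero hv, zero_mul]
  rw [hsupp, key, ← lintegral_const_mul' _ _ (by simp)]
  refine setLIntegral_congr_fun measurableSet_Ioo fun t ht => ?_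
  have hc : 0 < cos t := cos_pos_of_mem_Ioo ⟨by linarith [ht.1, pi_pos], ht.2⟩
  have hs : 0 < sin t := sin_pos_of_mem_Ioo ⟨ht.1, by linarith [pi_pos, ht.2]⟩
  have h1 : 1 - cos t ^ 2 = sin t * sin t := by nlinarith [sin_sq_add_cos_sq t]
  have h2 : |2 * cos t * (- sin t)| = 2 * (cos t * sin t) := by
    rw [mul_neg, abs_neg, abs_of_pos (by positivity), mul_assoc]
  rw [h1, h2, pow_two, invSqrt_mul_self hc.le, invSqrt_mul_self hs.le,
    ← ENNReal.ofReal_mul (by positivity), ← mul_assoc, ← ENNReal.ofReal_mul (by positivity)]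
  congr 1
  rw [show 2 * (cos t * sin t) * ((cos t)⁻¹ * (sin t)⁻¹) = 2 by field_simp]
  simp

lemma setLIntegral_Icc_cos_sq (h : ℝ → ENNReal) :
    ∫⁻ θ in Set.Icc 0 (2 * π), h (cos θ ^ 2) =
      2 * ∫⁻ v, invSqrt v * invSqrt (1 - v) * h v := by
  have hpi := pi_pos
  have hadd (c : ℝ) (hc : ∀ t, cos (c + t) ^ 2 = cos t ^ 2) :
      ∫⁻ θ in Set.Ioc c (c + π / 2), h (cos θ ^ 2) =
        ∫⁻ t in Set.Ioo 0 (π / 2), h (cos t ^ 2) := by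
    have := lintegral_image_eq_lintegral_abs_deriv_mul (s := Set.Ioo 0 (π / 2))
      (f := fun t => c + t) (f' := fun t => 1) measurableSet_Ioo
      (fun t _ => ((hasDerivAt_id t).const_add c).hasDerivWithinAt)
      (fun x _ y _ hxy => by simpa using hxy) (fun θ => h (cos θ ^ 2))
    rw [Set.image_const_add_Ioo, add_zero] at this
    rw [setLIntegral_congr Ioo_ae_eq_Ioc.symm, this]
    simp [hc]
  have hsub (c : ℝ) (hc : ∀ t, cos (c - t) ^ 2 = cos t ^ 2) :
      ∫⁻ θ in Set.Ioc (c - π / 2) c, h (cos θ ^ 2) =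
        ∫⁻ t in Set.Ioo 0 (π / 2), h (cos t ^ 2) := by
    have := lintegral_image_eq_lintegral_abs_deriv_mul (s := Set.Ioo 0 (π / 2))
      (f := fun t => c - t) (f' := fun t => -1) measurableSet_Ioo
      (fun t _ => ((hasDerivAt_id t).const_sub c).hasDerivWithinAt)
      (fun x _ y _ hxy => by simpa using hxy) (fun θ => h (cos θ ^ 2))
    rw [Set.image_const_sub_Ioo, sub_zero] at this
    rw [setLIntegral_congr Ioo_ae_eq_Ioc.symm, this]
    simp [hc]
  have hsplit {a b c : ℝ} (hab : a ≤ b) (hbc : b ≤ c) :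
      ∫⁻ θ in Set.Ioc a c, h (cos θ ^ 2) =
        (∫⁻ θ in Set.Ioc a b, h (cos θ ^ 2)) + ∫⁻ θ in Set.Ioc b c, h (cos θ ^ 2) := by
    rw [← Set.Ioc_union_Ioc_eq_Ioc hab hbc,
      lintegral_union measurableSet_Ioc (Set.Ioc_disjoint_Ioc_of_le le_rfl)]
  have e1 := hadd 0 (by simp)
  have e2 := hsub π (by simp [cos_pi_sub])
  have e3 := hadd π (by simp [add_comm π, cos_add_pi])
  have e4 := hsub (2 * π) (by simp [cos_two_pi_sub])
  rw [show (0 : ℝ) + π / 2 = π / 2 by ring] at e1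
  rw [show π - π / 2 = π / 2 by ring] at e2
  rw [show 2 * π - π / 2 = π + π / 2 by ring] at e4
  rw [setLIntegral_congr Ioc_ae_eq_Icc.symm, hsplit (b := π) (by linarith) (by linarith),
    hsplit (b := π / 2) (c := π) (by linarith) (by linarith),
    hsplit (a := π) (b := π + π / 2) (by linarith) (by linarith), e1, e2, e3, e4,
    lintegral_invSqrt_mul_eq_lintegral_cos_sq]
  ring

lemma lintegral_invSqrt_sub_mul {B v : ℝ} (hB : 0 < B) (hv : 0 < v) :
    ∫⁻ w, invSqrt w * invSqrt (1 - w) * invSqrt (B - v * w) =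
      ∫⁻ y, invSqrt y * invSqrt (1 - y) * invSqrt (v - B * y) := by
  have hv' : 0 < v⁻¹ := inv_pos.2 hv
  rw [lintegral_comp_mul_add _ (mul_pos hB hv').ne' 0]
  congr 1 with y
  rw [abs_of_pos (mul_pos hB hv'), add_zero, invSqrt_mul (mul_pos hB hv').le,
    show 1 - B * v⁻¹ * y = v⁻¹ * (v - B * y) by field_simp,
    show B - v * (B * v⁻¹ * y) = B * (1 - y) by field_simp,
    invSqrt_mul hv'.le, invSqrt_mul hB.le, invSqrt_mul hB.le, ENNReal.ofReal_mul hB.le]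
  calc _ = (ENNReal.ofReal B * (invSqrt B * invSqrt B)) *
        (ENNReal.ofReal v⁻¹ * (invSqrt v⁻¹ * invSqrt v⁻¹)) *
        (invSqrt y * invSqrt (1 - y) * invSqrt (v - B * y)) := by ring
    _ = _ := by rw [ofReal_mul_invSqrt_mul_self hB, ofReal_mul_invSqrt_mul_self hv', one_mul, one_mul]

lemma lintegral_invSqrt_one_sub_mul {C : ℝ} (hC : 0 < C) :
    ∫⁻ v, invSqrt v * invSqrt (1 - v) * invSqrt (v - (1 - C)) =
      ∫⁻ u, invSqrt u * invSqrt (1 - u) * invSqrt (1 - C * u) := by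
  rw [lintegral_comp_mul_add _ (neg_ne_zero.2 hC.ne') 1]
  congr 1 with u
  rw [abs_neg, abs_of_pos hC, show 1 - (-C * u + 1) = C * u by ring,
    show -C * u + 1 - (1 - C) = C * (1 - u) by ring, show -C * u + 1 = 1 - C * u by ring,
    invSqrt_mul hC.le, invSqrt_mul hC.le]
  calc _ = (ENNReal.ofReal C * (invSqrt C * invSqrt C)) *
        (invSqrt u * invSqrt (1 - u) * invSqrt (1 - C * u)) := by ring
    _ = _ := by rw [ofReal_mul_invSqrt_mul_self hC, one_mul]

lemma lintegral_lintegral_invSqrt {B : ℝ} (hB : 0 < B) (hB1 : B < 1) :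
    ∫⁻ v, ∫⁻ w, invSqrt v * invSqrt (1 - v) *
        (invSqrt w * invSqrt (1 - w) * invSqrt (B - v * w)) =
      ∫⁻ y, ∫⁻ u, invSqrt y * invSqrt (1 - y) *
        (invSqrt u * invSqrt (1 - u) * invSqrt (1 - u + B * (u * y))) := by
  calc
    _ = ∫⁻ v, ∫⁻ y, invSqrt v * invSqrt (1 - v) *
        (invSqrt y * invSqrt (1 - y) * invSqrt (v - B * y)) := by
      congr 1 with v
      rw [lintegral_const_mul _ (by fun_prop), lintegral_const_mul _ (by fun_prop)]
      rcases le_or_gt v 0 with hv | hv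
      · simp [invSqrt_of_nonpos hv]
      · rw [lintegral_invSqrt_sub_mul hB hv]
    _ = ∫⁻ y, ∫⁻ v, invSqrt v * invSqrt (1 - v) *
        (invSqrt y * invSqrt (1 - y) * invSqrt (v - B * y)) :=
      lintegral_lintegral_swap (by fun_prop)
    _ = _ := by
      congr 1 with y
      rw [lintegral_const_mul _ (by fun_prop)]
      by_cases hy : y ∈ Set.Ioo (0 : ℝ) 1
      · have hC : 0 < 1 - B * y := by nlinarith [hy.1, hy.2]
        have h := lintegral_invSqrt_one_sub_mul hC
        rw [sub_sub_cancel] at h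
        have e (u : ℝ) : 1 - u + B * (u * y) = 1 - (1 - B * y) * u := by ring
        simp_rw [e, ← h]
        rw [← lintegral_const_mul _ (by fun_prop)]
        congr 1 with v
        ring
      · simp [invSqrt_mul_invSqrt_one_sub_eq_zero hy]

lemma ofReal_arcosh_max_eq_lintegral {a p : ℝ} (ha : 0 < a) (hp : 0 < p) :
    ENNReal.ofReal (arcosh (max 1 (a / √p))) =
      ENNReal.ofReal (a / 2) *
        ∫⁻ x in Set.Ioo 0 1, invSqrt x * invSqrt (a ^ 2 * x - p) := by
  have hsp : 0 < √p := Real.sqrt_pos.2 hp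
  have hsp2 : √p ^ 2 = p := Real.sq_sqrt hp.le
  rcases le_or_gt a (√p) with hap | hap
  · rw [max_eq_left ((div_le_one hsp).2 hap), arcosh_zero, ENNReal.ofReal_zero,
      setLIntegral_congr_fun (g := fun _ => 0) measurableSet_Ioo, lintegral_zero, mul_zero]
    intro x hx
    have : a ^ 2 ≤ p := by rw [← hsp2]; gcongr
    have : a ^ 2 * x ≤ p := by nlinarith [hx.1, hx.2]
    simp only
    rw [invSqrt_of_nonpos (x := a ^ 2 * x - p) (by linarith), mul_zero]
  have hpa : p < a ^ 2 := by rw [← hsp2]; gcongr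
  have hx0 : 0 < p / a ^ 2 := by positivity
  have hx1 : p / a ^ 2 < 1 := (div_lt_one (by positivity)).2 hpa
  set x₀ := p / a ^ 2 with hx₀
  have hsx₀ : √x₀ = √p / a := by
    rw [hx₀, Real.sqrt_div hp.le, Real.sqrt_sq ha.le]
  have hge : ∀ x, x₀ ≤ x → 1 ≤ a / √p * √x := fun x hx => by
    have : √p / a ≤ √x := hsx₀ ▸ Real.sqrt_le_sqrt hx
    calc 1 = a / √p * (√p / a) := by field_simp
      _ ≤ _ := by gcongr
  have hgt : ∀ x, x₀ < x → 1 < a / √p * √x := fun x hx => by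
    have : √p / a < √x := hsx₀ ▸ Real.sqrt_lt_sqrt hx0.le hx
    calc 1 = a / √p * (√p / a) := by field_simp
      _ < _ := by gcongr
  have hcont : ContinuousOn (fun x => arcosh (a / √p * √x)) (Set.Icc x₀ 1) :=
    continuousOn_arcosh.comp (by fun_prop) fun x hx => hge x hx.1
  have hderiv : ∀ x ∈ Set.Ioo x₀ 1, HasDerivAt (fun x => arcosh (a / √p * √x))
      (a / 2 * ((√x)⁻¹ * (√(a ^ 2 * x - p))⁻¹)) x := fun x hx => by
    have hx' : 0 < x := hx0.trans hx.1
    have h := (hasDerivAt_arcosh (hgt x hx.1)).comp x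
      ((Real.hasDerivAt_sqrt hx'.ne').const_mul (a / √p))
    refine h.congr_deriv ?_
    have h2 : (a / √p * √x) ^ 2 - 1 = (a ^ 2 * x - p) / p := by
      rw [mul_pow, div_pow, hsp2, Real.sq_sqrt hx'.le]
      field_simp
    rw [h2, Real.sqrt_div' _ hp.le]
    have hsx : 0 < √x := Real.sqrt_pos.2 hx'
    have hpos : 0 < a ^ 2 * x - p := by
      have := (div_lt_iff₀ (by positivity)).1 hx.1
      linarith
    have : 0 < √(a ^ 2 * x - p) := Real.sqrt_pos.2 hpos
    field_simp
  have hnn : ∀ x, 0 ≤ a / 2 * ((√x)⁻¹ * (√(a ^ 2 * x - p))⁻¹) := fun x => by positivity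
  have hint := intervalIntegral.integrableOn_deriv_of_nonneg hcont hderiv fun x _ => hnn x
  have hftc := intervalIntegral.integral_eq_sub_of_hasDerivAt_of_le hx1.le hcont hderiv
    ((intervalIntegrable_iff_integrableOn_Ioc_of_le hx1.le).2 hint)
  have h1 : a / √p * √x₀ = 1 := by rw [hsx₀]; field_simp
  simp only [Real.sqrt_one, mul_one, h1, arcosh_zero, sub_zero] at hftc
  rw [max_eq_right ((one_le_div hsp).2 hap.le), ← hftc,
    intervalIntegral.integral_of_le hx1.le,
    ofReal_integral_eq_lintegral_ofReal hint (ae_of_all _ hnn),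
    ← lintegral_const_mul _ (by fun_prop), ← lintegral_indicator measurableSet_Ioc,
    ← lintegral_indicator measurableSet_Ioo]
  refine lintegral_congr_ae ?_
  filter_upwards [Measure.ae_ne volume (1 : ℝ)] with x hx
  by_cases hxm : x ∈ Set.Ioc x₀ 1
  · rw [Set.indicator_of_mem hxm, Set.indicator_of_mem (show x ∈ Set.Ioo 0 1 from ⟨hx0.trans hxm.1, hxm.2.lt_of_ne hx⟩),
      ENNReal.ofReal_mul (by positivity), ENNReal.ofReal_mul (by positivity), invSqrt, invSqrt]
  · rw [Set.indicator_of_notMem hxm]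
    by_cases hxm' : x ∈ Set.Ioo (0 : ℝ) 1
    · have hle : x ≤ x₀ := not_lt.1 fun h => hxm ⟨h, hxm'.2.le⟩
      have := (le_div_iff₀ (by positivity)).1 hle
      rw [Set.indicator_of_mem hxm', invSqrt_of_nonpos (x := a ^ 2 * x - p) (by linarith),
        mul_zero, mul_zero]
    · rw [Set.indicator_of_notMem hxm']

lemma measurePreserving_finThree (μ : Measure ℝ) [SigmaFinite μ] :
    MeasurePreserving (fun x : Fin 3 → ℝ => (x 0, x 1, x 2))
      (Measure.pi fun _ => μ) (μ.prod (μ.prod μ)) :=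
  ((MeasurePreserving.id μ).prod (measurePreserving_piFinTwo fun _ : Fin 2 => μ)).comp
    (measurePreserving_piFinSuccAbove (fun _ : Fin 3 => μ) 0)

lemma volume_restrict_pi_finThree (s : Set ℝ) :
    (volume : Measure (Fin 3 → ℝ)).restrict (Set.univ.pi fun _ => s) =
      Measure.pi fun _ => volume.restrict s := by
  rw [volume_pi, Measure.restrict_pi_pi]

lemma ae_cos_ne (c : ℝ) : ∀ᵐ θ, cos θ ≠ c := by
  have hcount : {θ : ℝ | cos θ = c}.Countable := by
    rcases Set.eq_empty_or_nonempty {θ : ℝ | cos θ = c} with h | ⟨φ, hφ⟩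
    · simp [h]
    · refine ((Set.countable_range fun n : ℤ => 2 * n * π + φ).union
        (Set.countable_range fun n : ℤ => 2 * n * π - φ)).mono fun θ hθ => ?_
      obtain ⟨n, hn⟩ := Real.cos_eq_cos_iff.1 ((show cos φ = c from hφ).trans
        (show cos θ = c from hθ).symm)
      exact hn.imp (fun h => ⟨n, h.symm⟩) fun h => ⟨n, h.symm⟩
  rw [ae_iff]
  simpa using hcount.measure_zero volume

lemma intervalIntegrable_log_norm_circleMap_sub (r : ℂ) :
    IntervalIntegrable (fun θ => log ‖circleMap 0 1 θ - r‖) volume 0 (2 * π) :=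
  circleIntegrable_log_norm_sub_const 1

lemma integral_log_norm_circleMap_sub (r : ℂ) :
    ∫ θ in 0..2 * π, log ‖circleMap 0 1 θ - r‖ = 2 * π * log⁺ ‖r‖ := by
  have h := circleAverage_log_norm_sub_const_eq_posLog (a := r)
  rw [circleAverage_def, smul_eq_mul, inv_mul_eq_iff_eq_mul₀ (by positivity)] at h
  exact h

/-- The roots of `z² - 2tz + 1` for real `t`. -/
lemma exists_roots_posLog_add_eq_arcosh (t : ℝ) :
    ∃ r₁ r₂ : ℂ, r₁ + r₂ = 2 * t ∧ r₁ * r₂ = 1 ∧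
      log⁺ ‖r₁‖ + log⁺ ‖r₂‖ = arcosh (max 1 |t|) := by
  rcases le_or_gt |t| 1 with h | h
  · have ht : t ^ 2 ≤ 1 := (sq_le_one_iff_abs_le_one t).2 h
    set s := √(1 - t ^ 2)
    have hs : s ^ 2 = 1 - t ^ 2 := Real.sq_sqrt (by linarith)
    have hnorm : ∀ e : ℝ, e ^ 2 = s ^ 2 → ‖(⟨t, e⟩ : ℂ)‖ = 1 := fun e he => by
      rw [Complex.norm_def, Complex.normSq_mk, show t * t + e * e = 1 by nlinarith, Real.sqrt_one]
    refine ⟨⟨t, s⟩, ⟨t, -s⟩, ?_, ?_, ?_⟩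
    · apply Complex.ext <;> simp; ring
    · apply Complex.ext <;> simp
      · nlinarith
      · ring
    · rw [hnorm s rfl, hnorm (-s) (by ring), max_eq_left h]
      simp
  · set s := √(|t| ^ 2 - 1)
    have hs0 : 0 ≤ s := Real.sqrt_nonneg _
    have hs : s ^ 2 = |t| ^ 2 - 1 := Real.sq_sqrt (by nlinarith)
    have key : log⁺ (|t| + s) + log⁺ (|t| - s) = arcosh (max 1 |t|) := by
      have h1 : 0 < |t| - s := by nlinarith
      have h2 : |t| - s ≤ 1 := by nlinarith
      rw [max_eq_right h.le, arcosh, posLog_eq_log (by rw [abs_of_nonneg] <;> linarith),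
        (posLog_eq_zero_iff _).2 (by rw [abs_of_pos h1]; exact h2), add_zero]
    have hn1 : |(|t| + s)| = |t| + s := abs_of_pos (by linarith)
    have hn2 : |(|t| - s)| = |t| - s := abs_of_pos (by nlinarith)
    rcases le_total 0 t with h0 | h0
    · rw [abs_of_nonneg h0] at *
      refine ⟨((t + s : ℝ) : ℂ), ((t - s : ℝ) : ℂ), ?_, ?_, ?_⟩
      · push_cast; ring
      · rw [← Complex.ofReal_mul, show (t + s) * (t - s) = 1 by nlinarith, Complex.ofReal_one]
      · rw [Complex.norm_real, Complex.norm_real, norm_eq_abs, norm_eq_abs, hn1, hn2, key]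
    · rw [abs_of_nonpos h0] at *
      refine ⟨((t - s : ℝ) : ℂ), ((t + s : ℝ) : ℂ), ?_, ?_, ?_⟩
      · push_cast; ring
      · rw [← Complex.ofReal_mul, show (t - s) * (t + s) = 1 by nlinarith, Complex.ofReal_one]
      · rw [Complex.norm_real, Complex.norm_real, norm_eq_abs, norm_eq_abs,
          show t - s = -(-t + s) by ring, show t + s = -(-t - s) by ring, abs_neg, abs_neg,
          hn1, hn2, key]

lemma log_abs_add_mul_cos_ae_eq (k : ℝ) {q : ℝ} (hq : q ≠ 0) :
    ∃ r₁ r₂ : ℂ, log⁺ ‖r₁‖ + log⁺ ‖r₂‖ = arcosh (max 1 (|k| / |q|)) ∧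
      ∀ᵐ θ, log |k + q * cos θ| = log (|q| / 2) +
        (log ‖circleMap 0 1 θ - r₁‖ + log ‖circleMap 0 1 θ - r₂‖) := by
  obtain ⟨r₁, r₂, hadd, hmul, hlog⟩ := exists_roots_posLog_add_eq_arcosh (-(k / q))
  refine ⟨r₁, r₂, by rw [hlog, abs_neg, abs_div], ?_⟩
  filter_upwards [ae_cos_ne (-(k / q))] with θ hθ
  have hz : circleMap 0 1 θ = cos θ + sin θ * Complex.I := by
    simp [circleMap, Complex.exp_mul_I]
  have hnz : ‖circleMap 0 1 θ‖ = 1 := by simp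
  have hsc : (cos θ : ℂ) ^ 2 + (sin θ : ℂ) ^ 2 = 1 := by
    exact_mod_cast cos_sq_add_sin_sq θ
  have hprod : (circleMap 0 1 θ - r₁) * (circleMap 0 1 θ - r₂) =
      circleMap 0 1 θ * ((2 / q * (k + q * cos θ) : ℝ) : ℂ) := by
    have e1 : (circleMap 0 1 θ - r₁) * (circleMap 0 1 θ - r₂) =
      circleMap 0 1 θ ^ 2 - (r₁ + r₂) * circleMap 0 1 θ + r₁ * r₂ := by ring
    have e2 : 2 / q * (k + q * cos θ) = 2 * (k / q) + 2 * cos θ := by field_simp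
    rw [e1, hadd, hmul, e2, hz]
    push_cast at hsc ⊢
    linear_combination (-1 : ℂ) * hsc + Complex.sin θ ^ 2 * Complex.I_sq
  have hnorm : ‖circleMap 0 1 θ - r₁‖ * ‖circleMap 0 1 θ - r₂‖ = 2 / |q| * |k + q * cos θ| := by
    rw [← norm_mul, hprod, norm_mul, hnz, one_mul, Complex.norm_real, norm_eq_abs, abs_mul,
      abs_div, abs_two]
  have hne : |k + q * cos θ| ≠ 0 := by
    rw [abs_ne_zero]
    intro h
    apply hθ
    field_simp
    linarith
  have hq' : |q| ≠ 0 := abs_ne_zero.2 hq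
  have hnp : ‖circleMap 0 1 θ - r₁‖ * ‖circleMap 0 1 θ - r₂‖ ≠ 0 := by
    rw [hnorm]; positivity
  rw [← log_mul (left_ne_zero_of_mul hnp) (right_ne_zero_of_mul hnp), hnorm,
    ← log_mul (by positivity) (by positivity)]
  congr 1
  field_simp

lemma intervalIntegrable_log_abs_add_mul_cos (k : ℝ) {q : ℝ} (hq : q ≠ 0) :
    IntervalIntegrable (fun θ => log |k + q * cos θ|) volume 0 (2 * π) := by
  obtain ⟨r₁, r₂, -, hae⟩ := log_abs_add_mul_cos_ae_eq k hq
  refine ((intervalIntegrable_const (c := log (|q| / 2))).add ((intervalIntegrable_log_norm_circleMap_sub r₁).add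
    (intervalIntegrable_log_norm_circleMap_sub r₂))).congr_ae (ae_restrict_of_ae ?_)
  filter_upwards [hae] with θ hθ using hθ.symm

lemma integral_log_abs_add_mul_cos (k : ℝ) {q : ℝ} (hq : q ≠ 0) :
    ∫ θ in 0..2 * π, log |k + q * cos θ| =
      2 * π * (log (|q| / 2) + arcosh (max 1 (|k| / |q|))) := by
  obtain ⟨r₁, r₂, hr, hae⟩ := log_abs_add_mul_cos_ae_eq k hq
  have h₁ := intervalIntegrable_log_norm_circleMap_sub r₁
  have h₂ := intervalIntegrable_log_norm_circleMap_sub r₂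
  rw [intervalIntegral.integral_congr_ae (hae.mono fun θ h _ => h),
    intervalIntegral.integral_add intervalIntegrable_const (h₁.add h₂),
    intervalIntegral.integral_add h₁ h₂, integral_log_norm_circleMap_sub,
    integral_log_norm_circleMap_sub, ← hr]
  simp
  ring

lemma integrable_log_abs_cos :
    Integrable (fun θ => log |cos θ|) (volume.restrict (Set.Icc 0 (2 * π))) := by
  have h := intervalIntegrable_log_abs_add_mul_cos 0 one_ne_zero
  simp only [zero_add, one_mul] at h
  rwa [intervalIntegrable_iff_integrableOn_Icc_of_le (by positivity)] at h

lemma integral_log_abs_cos :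
    ∫ θ in Set.Icc 0 (2 * π), log |cos θ| = -(2 * π * log 2) := by
  have h := integral_log_abs_add_mul_cos 0 one_ne_zero
  simp only [zero_add, one_mul, abs_zero, abs_one, zero_div, max_eq_left zero_le_one,
    arcosh_zero, add_zero] at h
  rw [integral_Icc_eq_integral_Ioc, ← intervalIntegral.integral_of_le (by positivity), h,
    one_div, log_inv]
  ring

lemma ae_prod_cos_ne_zero :
    ∀ᵐ z : ℝ × ℝ ∂(volume.restrict (Set.Icc 0 (2 * π))).prod (volume.restrict (Set.Icc 0 (2 * π))),
      cos z.1 ≠ 0 ∧ cos z.2 ≠ 0 := by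
  have h : ∀ᵐ θ ∂(volume.restrict (Set.Icc 0 (2 * π))), cos θ ≠ 0 := ae_restrict_of_ae (ae_cos_ne 0)
  exact (Measure.quasiMeasurePreserving_fst.ae h).and (Measure.quasiMeasurePreserving_snd.ae h)

lemma integrable_log_abs_add_mul_cos_mul (k : ℝ) {c d : ℝ} (hc : c ≠ 0) (hd : d ≠ 0) :
    Integrable (fun θ => log |k + 8 * cos θ * c * d|) (volume.restrict (Set.Icc 0 (2 * π))) := by
  have hq : 8 * c * d ≠ 0 := by simp [hc, hd]
  have e (θ : ℝ) : 8 * cos θ * c * d = 8 * c * d * cos θ := by ring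
  simp_rw [e]
  have := intervalIntegrable_log_abs_add_mul_cos k hq
  rwa [intervalIntegrable_iff_integrableOn_Icc_of_le (by positivity)] at this

lemma setIntegral_log_abs_add_mul_cos_mul (k : ℝ) {c d : ℝ} (hc : c ≠ 0) (hd : d ≠ 0) :
    ∫ θ in Set.Icc 0 (2 * π), log |k + 8 * cos θ * c * d| =
      2 * π * ((log 4 + (log |c| + log |d|)) +
        arcosh (max 1 (|k| / 8 / √(c ^ 2 * d ^ 2)))) := by
  have hq : 8 * c * d ≠ 0 := by simp [hc, hd]
  have e (θ : ℝ) : 8 * cos θ * c * d = 8 * c * d * cos θ := by ring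
  have h1 := abs_ne_zero.2 hc
  have h2 := abs_ne_zero.2 hd
  have h8 : |8 * c * d| = 8 * (|c| * |d|) := by
    rw [abs_mul, abs_mul, abs_of_pos (by norm_num : (0 : ℝ) < 8), mul_assoc]
  simp_rw [e]
  rw [integral_Icc_eq_integral_Ioc, ← intervalIntegral.integral_of_le (by positivity),
    integral_log_abs_add_mul_cos k hq, ← log_mul h1 h2,
    ← log_mul (by norm_num) (mul_ne_zero h1 h2), h8, ← mul_pow, Real.sqrt_sq_eq_abs, abs_mul,
    div_div, show 8 * (|c| * |d|) / 2 = 4 * (|c| * |d|) by ring]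

lemma log_abs_add_mul_cos_le {k : ℝ} (hk : |k| < 8) (x y w : ℝ) :
    log |k + 8 * cos x * cos y * cos w| ≤ log 16 := by
  rcases eq_or_ne (k + 8 * cos x * cos y * cos w) 0 with h | h
  · rw [h, abs_zero, log_zero]
    exact log_nonneg (by norm_num)
  · refine log_le_log (abs_pos.2 h) ((abs_add_le _ _).trans ?_)
    have h1 := abs_cos_le_one x
    have h2 := abs_cos_le_one y
    have h3 := abs_cos_le_one w
    have : |8 * cos x * cos y * cos w| ≤ 8 := by
      rw [abs_mul, abs_mul, abs_mul, abs_of_pos (by norm_num : (0 : ℝ) < 8)]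
      calc 8 * |cos x| * |cos y| * |cos w| ≤ 8 * 1 * 1 * 1 := by gcongr
        _ = 8 := by norm_num
    linarith

lemma integrable_log_abs_add_mul_cos_prod {k : ℝ} (hk : |k| < 8) :
    Integrable (fun z : ℝ × ℝ × ℝ => log |k + 8 * cos z.1 * cos z.2.1 * cos z.2.2|)
      ((volume.restrict (Set.Icc 0 (2 * π))).prod
        ((volume.restrict (Set.Icc 0 (2 * π))).prod (volume.restrict (Set.Icc 0 (2 * π))))) := by
  set μ : Measure ℝ := volume.restrict (Set.Icc 0 (2 * π)) with hμ
  have hmeas : Measurable fun z : ℝ × ℝ × ℝ =>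
      log |k + 8 * cos z.1 * cos z.2.1 * cos z.2.2| := by fun_prop
  rw [integrable_prod_iff' hmeas.aestronglyMeasurable]
  refine ⟨ae_prod_cos_ne_zero.mono fun z hz =>
    integrable_log_abs_add_mul_cos_mul k hz.1 hz.2, ?_⟩
  have hdom : Integrable (fun z : ℝ × ℝ => 2 * π * (2 * log 16 -
      (log 4 + (log |cos z.1| + log |cos z.2|)))) (μ.prod μ) :=
    ((integrable_const _).sub ((integrable_const _).add
      ((integrable_log_abs_cos.comp_fst μ).add (integrable_log_abs_cos.comp_snd μ)))).const_mul _
  refine hdom.mono' hmeas.norm.stronglyMeasurable.integral_prod_left.aestronglyMeasurable ?_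
  filter_upwards [ae_prod_cos_ne_zero] with z hz
  have hi := integrable_log_abs_add_mul_cos_mul k hz.1 hz.2
  rw [norm_of_nonneg (integral_nonneg fun _ => norm_nonneg _)]
  calc ∫ θ, ‖log |k + 8 * cos θ * cos z.1 * cos z.2|‖ ∂μ
      ≤ ∫ θ, (2 * log 16 - log |k + 8 * cos θ * cos z.1 * cos z.2|) ∂μ := by
        refine integral_mono hi.norm ((integrable_const _).sub hi) fun θ => ?_
        have h0 : 0 ≤ log 16 := log_nonneg (by norm_num)
        have := log_abs_add_mul_cos_le hk θ z.1 z.2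
        rw [norm_eq_abs]
        exact abs_le.2 ⟨by simp only; linarith, by simp only; linarith⟩
    _ = 2 * π * (2 * log 16) - 2 * π * ((log 4 + (log |cos z.1| + log |cos z.2|)) +
          arcosh (max 1 (|k| / 8 / √(cos z.1 ^ 2 * cos z.2 ^ 2)))) := by
        rw [integral_sub (integrable_const _) hi,
          setIntegral_log_abs_add_mul_cos_mul k hz.1 hz.2, integral_const]
        simp [pi_pos.le]
    _ ≤ _ := by
        have := arcosh_nonneg (le_max_left 1 (|k| / 8 / √(cos z.1 ^ 2 * cos z.2 ^ 2)))
        rw [← mul_sub]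
        exact mul_le_mul_of_nonneg_left (by linarith) (by positivity)

lemma integral_log_abs_add_mul_cos_pi_eq {k : ℝ} (hk : |k| < 8) :
    ∫ θ : Fin 3 → ℝ in Set.univ.pi fun _ => Set.Icc 0 (2 * π),
        log |k + 8 * cos (θ 0) * cos (θ 1) * cos (θ 2)| =
      2 * π * ∫ z : ℝ × ℝ, arcosh (max 1 (|k| / 8 / √(cos z.1 ^ 2 * cos z.2 ^ 2)))
        ∂(volume.restrict (Set.Icc 0 (2 * π))).prod (volume.restrict (Set.Icc 0 (2 * π))) := by
  set μ : Measure ℝ := volume.restrict (Set.Icc 0 (2 * π)) with hμ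
  have hint := integrable_log_abs_add_mul_cos_prod hk
  have hmp := measurePreserving_finThree μ
  have hmeas : Measurable fun z : ℝ × ℝ × ℝ =>
      log |k + 8 * cos z.1 * cos z.2.1 * cos z.2.2| := by fun_prop
  rw [volume_restrict_pi_finThree]
  have hmap := integral_map hmp.measurable.aemeasurable
    (hmeas.aestronglyMeasurable (μ := (Measure.pi fun _ => μ).map _))
  rw [hmp.map_eq] at hmap
  rw [← hmap, integral_prod_symm _ hint]
  have hlog : Integrable (fun z : ℝ × ℝ => log 4 + (log |cos z.1| + log |cos z.2|)) (μ.prod μ) :=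
    (integrable_const _).add
      ((integrable_log_abs_cos.comp_fst μ).add (integrable_log_abs_cos.comp_snd μ))
  have hae : ∀ᵐ z ∂μ.prod μ,
      ∫ θ, log |k + 8 * cos θ * cos z.1 * cos z.2| ∂μ =
      2 * π * ((log 4 + (log |cos z.1| + log |cos z.2|)) +
        arcosh (max 1 (|k| / 8 / √(cos z.1 ^ 2 * cos z.2 ^ 2)))) := by
    filter_upwards [ae_prod_cos_ne_zero] with z hz using
      setIntegral_log_abs_add_mul_cos_mul k hz.1 hz.2
  have hA : Integrable (fun z : ℝ × ℝ =>
      arcosh (max 1 (|k| / 8 / √(cos z.1 ^ 2 * cos z.2 ^ 2)))) (μ.prod μ) := by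
    refine ((hint.integral_prod_right.const_mul (2 * π)⁻¹).sub hlog).congr ?_
    filter_upwards [hae] with z hz
    simp only [Pi.sub_apply]
    rw [hz]
    field_simp
    ring
  have hlog0 : ∫ z : ℝ × ℝ, (log 4 + (log |cos z.1| + log |cos z.2|)) ∂μ.prod μ = 0 := by
    have h4 : log 4 = 2 * log 2 := by
      rw [show (4 : ℝ) = 2 ^ 2 by norm_num, log_pow]; norm_num
    have h1 := integrable_log_abs_cos.comp_fst μ
    have h2 := integrable_log_abs_cos.comp_snd μ
    have h12 : Integrable (fun z : ℝ × ℝ => log |cos z.1| + log |cos z.2|) (μ.prod μ) := h1.add h2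
    have hreal : μ.real Set.univ = 2 * π := by simp [hμ, pi_pos.le]
    rw [integral_add (integrable_const _) h12, integral_add h1 h2,
      integral_fun_fst (fun θ => log |cos θ|), integral_fun_snd (fun θ => log |cos θ|),
      integral_log_abs_cos, integral_const, ← Set.univ_prod_univ, measureReal_prod_prod, hreal, h4]
    simp only [smul_eq_mul]
    ring
  rw [integral_congr_ae hae, integral_const_mul, integral_add hlog hA, hlog0, zero_add]

lemma lintegral_arcosh_eq {a : ℝ} (ha : 0 < a) (ha1 : a < 1) :
    ∫⁻ z : ℝ × ℝ, ENNReal.ofReal (arcosh (max 1 (a / √(cos z.1 ^ 2 * cos z.2 ^ 2))))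
        ∂(volume.restrict (Set.Icc 0 (2 * π))).prod (volume.restrict (Set.Icc 0 (2 * π))) =
      4 * ENNReal.ofReal (a / 2) * ∫⁻ x in Set.Ioo 0 1, ∫⁻ y, ∫⁻ u, invSqrt x *
        (invSqrt y * invSqrt (1 - y) *
          (invSqrt u * invSqrt (1 - u) * invSqrt (1 - u + a ^ 2 * x * (u * y)))) := by
  have hmeas : Measurable fun z : ℝ × ℝ =>
      ENNReal.ofReal (arcosh (max 1 (a / √(cos z.1 ^ 2 * cos z.2 ^ 2)))) := by
    unfold arcosh
    fun_prop
  rw [lintegral_prod _ hmeas.aemeasurable]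
  simp only
  have hinner (v : ℝ) := setLIntegral_Icc_cos_sq
    fun w => ENNReal.ofReal (arcosh (max 1 (a / √(v * w))))
  simp_rw [hinner]
  rw [setLIntegral_Icc_cos_sq fun v => 2 * ∫⁻ w, invSqrt w * invSqrt (1 - w) *
    ENNReal.ofReal (arcosh (max 1 (a / √(v * w))))]
  calc
    _ = 2 * ∫⁻ v, 2 * ∫⁻ w, ENNReal.ofReal (a / 2) * ∫⁻ x in Set.Ioo 0 1,
        invSqrt x * (invSqrt v * invSqrt (1 - v) *
          (invSqrt w * invSqrt (1 - w) * invSqrt (a ^ 2 * x - v * w))) := by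
      congr 2 with v
      rw [mul_left_comm, ← lintegral_const_mul _ (by unfold arcosh; fun_prop)]
      congr 2 with w
      rcases le_or_gt v 0 with hv | hv
      · simp [invSqrt_of_nonpos hv]
      rcases le_or_gt w 0 with hw | hw
      · simp [invSqrt_of_nonpos hw]
      rw [ofReal_arcosh_max_eq_lintegral ha (mul_pos hv hw), ← mul_assoc, mul_left_comm, ← lintegral_const_mul _ (by fun_prop)]
      congr 2 with x
      ring
    _ = 4 * ENNReal.ofReal (a / 2) * ∫⁻ v, ∫⁻ w, ∫⁻ x in Set.Ioo 0 1,
        invSqrt x * (invSqrt v * invSqrt (1 - v) *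
          (invSqrt w * invSqrt (1 - w) * invSqrt (a ^ 2 * x - v * w))) := by
      simp_rw [lintegral_const_mul' _ _ ENNReal.ofReal_ne_top,
        lintegral_const_mul' _ _ ENNReal.ofNat_ne_top,
        lintegral_const_mul' _ _ ENNReal.ofReal_ne_top]
      ring
    _ = 4 * ENNReal.ofReal (a / 2) * ∫⁻ x in Set.Ioo 0 1, ∫⁻ v, ∫⁻ w,
        invSqrt x * (invSqrt v * invSqrt (1 - v) *
          (invSqrt w * invSqrt (1 - w) * invSqrt (a ^ 2 * x - v * w))) := by
      congr 1
      have hswap (v : ℝ) := lintegral_lintegral_swap (μ := volume)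
        (ν := volume.restrict (Set.Ioo (0 : ℝ) 1))
        (f := fun w x => invSqrt x * (invSqrt v * invSqrt (1 - v) *
          (invSqrt w * invSqrt (1 - w) * invSqrt (a ^ 2 * x - v * w)))) (by fun_prop)
      simp_rw [hswap]
      refine lintegral_lintegral_swap (Measurable.aemeasurable ?_)
      exact Measurable.lintegral_prod_right'
        (f := fun p : (ℝ × ℝ) × ℝ => invSqrt p.1.2 * (invSqrt p.1.1 * invSqrt (1 - p.1.1) *
          (invSqrt p.2 * invSqrt (1 - p.2) * invSqrt (a ^ 2 * p.1.2 - p.1.1 * p.2))))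
        (by fun_prop)
    _ = _ := by
      congr 1
      refine setLIntegral_congr_fun measurableSet_Ioo fun x hx => ?_
      have hB : 0 < a ^ 2 * x := mul_pos (by positivity) hx.1
      have hB1 : a ^ 2 * x < 1 := by nlinarith [hx.1, hx.2]
      have htop : invSqrt x ≠ ⊤ := ENNReal.ofReal_ne_top
      simp_rw [lintegral_const_mul' _ _ htop]
      rw [lintegral_lintegral_invSqrt hB hB1]

lemma setLIntegral_Icc_invSqrt_mul (f : ℝ → ENNReal) :
    ∫⁻ x in Set.Icc 0 1, invSqrt x * invSqrt (1 - x) * f x =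
      ∫⁻ x, invSqrt x * invSqrt (1 - x) * f x := by
  rw [← lintegral_indicator measurableSet_Icc]
  congr 1 with x
  by_cases hx : x ∈ Set.Icc (0 : ℝ) 1
  · simp [hx]
  · rw [Set.indicator_of_notMem hx, invSqrt_mul_invSqrt_one_sub_eq_zero
      fun h => hx (Set.Ioo_subset_Icc_self h), zero_mul]

lemma lintegral_cube_eq (A : ℝ) :
    ∫⁻ x : Fin 3 → ℝ in Set.univ.pi fun _ => Set.Icc 0 1,
        ENNReal.ofReal (1 / √(x 0 * x 1 * x 2 * (1 - x 0) * (1 - x 1) *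
          (1 - x 0 + A * (x 0 * x 1 * x 2)))) =
      ∫⁻ x in Set.Ioo 0 1, ∫⁻ y, ∫⁻ u, invSqrt x *
        (invSqrt y * invSqrt (1 - y) *
          (invSqrt u * invSqrt (1 - u) * invSqrt (1 - u + A * x * (u * y)))) := by
  set μ : Measure ℝ := volume.restrict (Set.Icc 0 1) with hμ
  have hmp := measurePreserving_finThree μ
  calc
    _ = ∫⁻ x : Fin 3 → ℝ in Set.univ.pi fun _ => Set.Icc 0 1, invSqrt (x 2) *
        (invSqrt (x 1) * invSqrt (1 - x 1) *
          (invSqrt (x 0) * invSqrt (1 - x 0) *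
            invSqrt (1 - x 0 + A * x 2 * (x 0 * x 1)))) := by
      refine setLIntegral_congr_fun (MeasurableSet.univ_pi fun _ => measurableSet_Icc)
        fun x hx => ?_
      obtain ⟨h0, h0'⟩ := hx 0 trivial
      obtain ⟨h1, h1'⟩ := hx 1 trivial
      obtain ⟨h2, h2'⟩ := hx 2 trivial
      have h3 : 0 ≤ 1 - x 0 := by linarith
      have h4 : 0 ≤ 1 - x 1 := by linarith
      have e : A * (x 0 * x 1 * x 2) = A * x 2 * (x 0 * x 1) := by ring
      rw [one_div, e]
      change invSqrt _ = _
      rw [invSqrt_mul (by positivity), invSqrt_mul (by positivity), invSqrt_mul (by positivity),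
        invSqrt_mul (by positivity), invSqrt_mul h0]
      ring
    _ = ∫⁻ z : ℝ × ℝ × ℝ, invSqrt z.2.2 * (invSqrt z.2.1 * invSqrt (1 - z.2.1) *
          (invSqrt z.1 * invSqrt (1 - z.1) *
            invSqrt (1 - z.1 + A * z.2.2 * (z.1 * z.2.1)))) ∂μ.prod (μ.prod μ) := by
      rw [volume_restrict_pi_finThree, ← hmp.lintegral_comp (by fun_prop)]
    _ = ∫⁻ x in Set.Icc 0 1, ∫⁻ y in Set.Icc 0 1, ∫⁻ u in Set.Icc 0 1, invSqrt x *
        (invSqrt y * invSqrt (1 - y) *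
          (invSqrt u * invSqrt (1 - u) * invSqrt (1 - u + A * x * (u * y)))) := by
      rw [lintegral_prod_symm _ (by fun_prop), lintegral_prod_symm]
      refine Measurable.aemeasurable ?_
      exact Measurable.lintegral_prod_left'
        (f := fun z : ℝ × ℝ × ℝ => invSqrt z.2.2 * (invSqrt z.2.1 * invSqrt (1 - z.2.1) *
          (invSqrt z.1 * invSqrt (1 - z.1) *
            invSqrt (1 - z.1 + A * z.2.2 * (z.1 * z.2.1))))) (by fun_prop)
    _ = _ := by
      rw [setLIntegral_congr Ioo_ae_eq_Icc.symm]
      congr 1 with x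
      have htop (x : ℝ) : invSqrt x ≠ ⊤ := ENNReal.ofReal_ne_top
      simp_rw [lintegral_const_mul' _ _ (htop _),
        lintegral_const_mul' _ _ (ENNReal.mul_ne_top (htop _) (htop _)),
        setLIntegral_Icc_invSqrt_mul]

/-- For `0 < |k| < 8`, the logarithmic Mahler measure of
`k + (x+x⁻¹)(y+y⁻¹)(z+z⁻¹)` as a triple integral:
`(2π)⁻³ ∫ log|k + 8 cos θ₁ cos θ₂ cos θ₃|
  = (|k|/(16π²)) ∫_{[0,1]³} dx₁dx₂dx₃ /
      √(x₁x₂x₃(1−x₁)(1−x₂)(1−x₁+(k²/64)x₁x₂x₃))`. -/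
theorem stmt11 (k : ℝ) (hk0 : 0 < |k|) (hk : |k| < 8) :
    ((2 * π) ^ 3)⁻¹ *
        (∫ θ : Fin 3 → ℝ in Set.univ.pi fun _ => Set.Icc 0 (2 * π),
          Real.log |k + 8 * Real.cos (θ 0) * Real.cos (θ 1) * Real.cos (θ 2)|) =
      |k| / (16 * π ^ 2) *
        ∫ x : Fin 3 → ℝ in Set.univ.pi fun _ => Set.Icc 0 1,
          1 / Real.sqrt (x 0 * x 1 * x 2 * (1 - x 0) * (1 - x 1) *
            (1 - x 0 + k ^ 2 / 64 * (x 0 * x 1 * x 2))) := by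
  set a := |k| / 8 with ha
  have ha0 : 0 < a := by positivity
  have ha1 : a < 1 := by rw [ha]; linarith
  have hA : k ^ 2 / 64 = a ^ 2 := by rw [ha, div_pow, sq_abs]; norm_num
  have hmeas : Measurable fun z : ℝ × ℝ =>
      arcosh (max 1 (a / √(cos z.1 ^ 2 * cos z.2 ^ 2))) := by
    unfold arcosh
    fun_prop
  rw [integral_log_abs_add_mul_cos_pi_eq hk, integral_eq_lintegral_of_nonneg_ae
    (ae_of_all _ fun z => arcosh_nonneg (le_max_left _ _)) hmeas.aestronglyMeasurable,
    lintegral_arcosh_eq ha0 ha1, hA, integral_eq_lintegral_of_nonneg_ae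
    (ae_of_all _ fun x => by positivity) (Measurable.aestronglyMeasurable (by fun_prop)),
    lintegral_cube_eq,
    ENNReal.toReal_mul, ENNReal.toReal_mul, ENNReal.toReal_ofReal (by positivity), ha]
  simp only [ENNReal.toReal_ofNat]
  field_simp
  ring
end

section
/- Let α, β be real numbers with α > −1/2, let x > 0 be real, and let λ, μ be complex numbers with λ² ≠ μ². Then ∫₀ˣ φ_λ(t) φ_μ(t) Δ(t) dt = (μ² − λ²)^{−1} · Δ(x) · ( φ_λ′(x) φ_μ(x) − φ_λ(x) φ_μ′(x) ), where φ_λ′ denotes the derivative of φ_λ with respect to t. -/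
open MeasureTheory Real

/-- Pochhammer symbol `(x)ₙ = x (x+1) ⋯ (x+n-1)` in `ℂ`. -/
noncomputable def poch (x : ℂ) (n : ℕ) : ℂ := (ascPochhammer ℂ n).eval x

/-- The Gauss hypergeometric series `₂F₁(a,b;c;z)`. -/
noncomputable def hyp2F1 (a b c z : ℂ) : ℂ :=
  ∑' n : ℕ, poch a n * poch b n / (poch c n * (n.factorial : ℂ)) * z ^ n

/-- The Jacobi function `φ_λ^{(α,β)}(t) = (cosh t)^{−α−β−1−iλ} ·
₂F₁((α+β+1+iλ)/2, (α−β+1+iλ)/2; α+1; tanh² t)`. -/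
noncomputable def jacobiPhi (α β : ℝ) (l : ℂ) (t : ℝ) : ℂ :=
  Complex.exp ((-(α : ℂ) - (β : ℂ) - 1 - Complex.I * l) * (Real.log (Real.cosh t) : ℂ)) *
    hyp2F1 (((α : ℂ) + β + 1 + Complex.I * l) / 2)
      (((α : ℂ) - β + 1 + Complex.I * l) / 2) ((α : ℂ) + 1) ((Real.tanh t : ℂ) ^ 2)

/-- The weight function `Δ(t) = (2 sinh t)^{2α+1} (2 cosh t)^{2β+1}`. -/
noncomputable def jacobiWeight (α β : ℝ) (t : ℝ) : ℝ :=
  (2 * Real.sinh t) ^ (2 * α + 1) * (2 * Real.cosh t) ^ (2 * β + 1)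

open Filter Topology

/-- The `n`-th Taylor coefficient at `0` of the Gauss hypergeometric series. -/
noncomputable def hypCoeff (a b c : ℂ) (n : ℕ) : ℂ :=
  poch a n * poch b n / (poch c n * (n.factorial : ℂ))

/-- The function `(z d/dz)^k ₂F₁(a,b;c;z)`, as a power series. -/
noncomputable def hypTheta (a b c : ℂ) (k : ℕ) (z : ℂ) : ℂ :=
  ∑' n : ℕ, (n : ℂ) ^ k * hypCoeff a b c n * z ^ n

theorem hypTheta_zero (a b c z : ℂ) : hypTheta a b c 0 z = hyp2F1 a b c z := by
  simp [hypTheta, hypCoeff, hyp2F1]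

theorem poch_succ (x : ℂ) (n : ℕ) : poch x (n + 1) = poch x n * (x + n) :=
  ascPochhammer_succ_eval n x

theorem poch_ne_zero {c : ℂ} (hc : ∀ n : ℕ, c + n ≠ 0) (n : ℕ) : poch c n ≠ 0 := by
  induction n with
  | zero => simp [poch]
  | succ n ih => rw [poch_succ]; exact mul_ne_zero ih (hc n)

theorem hypCoeff_succ (a b : ℂ) {c : ℂ} (hc : ∀ n : ℕ, c + n ≠ 0) (n : ℕ) :
    hypCoeff a b c (n + 1) = hypCoeff a b c n * ((a + n) * (b + n) / ((c + n) * (n + 1))) := by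
  have h₁ := poch_ne_zero hc n
  have h₂ := hc n
  have h₃ : (n : ℂ) + 1 ≠ 0 := by exact_mod_cast n.succ_ne_zero
  have h₄ : (n.factorial : ℂ) ≠ 0 := by exact_mod_cast n.factorial_ne_zero
  simp only [hypCoeff, poch_succ, Nat.factorial_succ]
  push_cast
  field_simp

theorem summable_hypCoeff (a b : ℂ) {c : ℂ} (hc : ∀ n : ℕ, c + n ≠ 0) {r : ℝ} (hr₀ : 0 ≤ r)
    (hr : r < 1) : Summable fun n ↦ ‖hypCoeff a b c n‖ * r ^ n := by
  have h : Tendsto (fun n : ℕ ↦ ‖(a + n) * (b + n) / ((c + n) * (n + 1))‖ * r) atTop (𝓝 r) := by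
    have h₁ := tendsto_add_mul_div_add_mul_atTop_nhds a c (1 : ℂ) one_ne_zero
    have h₂ := tendsto_add_mul_div_add_mul_atTop_nhds b 1 (1 : ℂ) one_ne_zero
    have h₃ := ((h₁.mul h₂).norm).mul_const r
    simp only [one_mul, div_one, norm_one, mul_one] at h₃
    refine h₃.congr fun n ↦ ?_
    rw [div_mul_div_comm, add_comm (1 : ℂ)]
  obtain ⟨q, hrq, hq⟩ := exists_between hr
  refine summable_of_ratio_norm_eventually_le hq ?_
  filter_upwards [h.eventually (gt_mem_nhds hrq)] with n hn
  rw [Real.norm_of_nonneg (by positivity), Real.norm_of_nonneg (by positivity),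
    hypCoeff_succ a b hc, norm_mul]
  calc _ = (‖(a + n) * (b + n) / ((c + n) * (n + 1))‖ * r) * (‖hypCoeff a b c n‖ * r ^ n) := by
        ring
    _ ≤ _ := by gcongr

theorem summable_natCast_mul {u : ℕ → ℂ}
    (hu : ∀ r : ℝ, 0 ≤ r → r < 1 → Summable fun n ↦ ‖u n‖ * r ^ n) {r : ℝ} (hr₀ : 0 ≤ r)
    (hr : r < 1) : Summable fun n : ℕ ↦ ‖(n : ℂ) * u n‖ * r ^ n := by
  obtain ⟨R, hrR, hR⟩ := exists_between hr
  have hR₀ : 0 < R := hr₀.trans_lt hrR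
  refine Summable.of_norm_bounded_eventually_nat (hu R hR₀.le hR) ?_
  have h := tendsto_self_mul_const_pow_of_abs_lt_one (r := r / R)
    (by rw [abs_of_nonneg (by positivity)]; exact (div_lt_one hR₀).2 hrR)
  filter_upwards [h.eventually (gt_mem_nhds one_pos)] with n hn
  rw [div_pow, ← mul_div_assoc, div_lt_one (by positivity)] at hn
  rw [Real.norm_of_nonneg (by positivity), norm_mul, Complex.norm_natCast]
  calc _ = ‖u n‖ * (n * r ^ n) := by ring
    _ ≤ _ := by gcongr

theorem summable_hypTheta (a b : ℂ) {c : ℂ} (hc : ∀ n : ℕ, c + n ≠ 0) (k : ℕ) :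
    ∀ r : ℝ, 0 ≤ r → r < 1 → Summable fun n : ℕ ↦ ‖(n : ℂ) ^ k * hypCoeff a b c n‖ * r ^ n := by
  induction k with
  | zero => simpa using fun r ↦ summable_hypCoeff a b hc (r := r)
  | succ k ih =>
    intro r hr₀ hr
    simpa only [pow_succ', mul_assoc] using summable_natCast_mul ih hr₀ hr

theorem hasDerivAt_tsum_mul_pow {u : ℕ → ℂ}
    (hu : ∀ r : ℝ, 0 ≤ r → r < 1 → Summable fun n ↦ ‖u n‖ * r ^ n) {z : ℂ} (hz : ‖z‖ < 1) :
    HasDerivAt (fun w ↦ ∑' n, u n * w ^ n) (∑' n : ℕ, u n * (n * z ^ (n - 1))) z := by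
  obtain ⟨r, hzr, hr⟩ := exists_between hz
  have hr₀ : 0 < r := (norm_nonneg z).trans_lt hzr
  refine hasDerivAt_tsum_of_isPreconnected (t := Metric.ball 0 r) (y₀ := 0)
    ((summable_natCast_mul hu hr₀.le hr).mul_right r⁻¹) Metric.isOpen_ball
    (convex_ball _ _).isPreconnected (fun n y _ ↦ (hasDerivAt_pow n y).const_mul (u n))
    (fun n y hy ↦ ?_) (by simpa using hr₀) ?_ (by simpa using hzr)
  · rw [mem_ball_zero_iff] at hy
    rcases n with _ | n
    · simp
    · have : ‖y‖ ^ n ≤ r ^ n := by gcongr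
      simp only [norm_mul, norm_pow, Nat.add_sub_cancel]
      calc _ ≤ ‖u (n + 1)‖ * (‖((n + 1 : ℕ) : ℂ)‖ * r ^ n) := by gcongr
        _ = _ := by rw [pow_succ]; field_simp
  · refine summable_of_ne_finset_zero (s := {0}) fun n hn ↦ ?_
    simp_all

theorem hasDerivAt_hypTheta (a b : ℂ) {c : ℂ} (hc : ∀ n : ℕ, c + n ≠ 0) (k : ℕ) {z : ℂ}
    (hz : ‖z‖ < 1) (hz₀ : z ≠ 0) :
    HasDerivAt (hypTheta a b c k) (hypTheta a b c (k + 1) z / z) z := by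
  refine (hasDerivAt_tsum_mul_pow (summable_hypTheta a b hc k) hz).congr_deriv ?_
  rw [hypTheta, ← tsum_div_const]
  refine tsum_congr fun n ↦ ?_
  rcases n with _ | n
  · simp
  · simp only [Nat.add_sub_cancel, pow_succ]
    field_simp

theorem hypTheta_differential_equation (a b : ℂ) {c : ℂ} (hc : ∀ n : ℕ, c + n ≠ 0) {z : ℂ}
    (hz : ‖z‖ < 1) :
    hypTheta a b c 2 z + (c - 1) * hypTheta a b c 1 z =
      z * (hypTheta a b c 2 z + (a + b) * hypTheta a b c 1 z + a * b * hypTheta a b c 0 z) := by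
  have hs (k : ℕ) : Summable fun n : ℕ ↦ (n : ℂ) ^ k * hypCoeff a b c n * z ^ n :=
    .of_norm <| by simpa using summable_hypTheta a b hc k ‖z‖ (norm_nonneg z) hz
  simp only [hypTheta]
  rw [← tsum_mul_left, ← tsum_mul_left, ← tsum_mul_left,
    ← (hs 2).tsum_add ((hs 1).mul_left _), ← (hs 2).tsum_add ((hs 1).mul_left _),
    ← ((hs 2).add ((hs 1).mul_left _)).tsum_add ((hs 0).mul_left _), ← tsum_mul_left,
    ((hs 2).add ((hs 1).mul_left _)).tsum_eq_zero_add]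
  simp only [Nat.cast_zero, ne_eq, OfNat.ofNat_ne_zero, not_false_eq_true, zero_pow, zero_mul,
    one_ne_zero, mul_zero, add_zero, zero_add]
  refine tsum_congr fun n ↦ ?_
  have h₂ := hc n
  have h₃ : (n : ℂ) + 1 ≠ 0 := by exact_mod_cast n.succ_ne_zero
  rw [hypCoeff_succ a b hc]
  push_cast
  field_simp
  ring

theorem hasDerivAt_real_tanh (t : ℝ) : HasDerivAt Real.tanh (1 - Real.tanh t ^ 2) t := by
  have hC := (Real.cosh_pos t).ne'
  rw [show Real.tanh = fun t ↦ Real.sinh t / Real.cosh t from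
    funext Real.tanh_eq_sinh_div_cosh]
  refine ((Real.hasDerivAt_sinh t).div (Real.hasDerivAt_cosh t) hC).congr_deriv ?_
  simp only
  field_simp

theorem contDiff_jacobiPhi {α : ℝ} (β : ℝ) (hα : -(1 / 2 : ℝ) < α) (l : ℂ) :
    ContDiff ℝ 1 (jacobiPhi α β l) := by
  have hc (n : ℕ) : (α : ℂ) + 1 + n ≠ 0 := by
    have : 0 < α + 1 + n := by have := n.cast_nonneg (α := ℝ); linarith
    exact_mod_cast this.ne'
  have hT : ContDiff ℝ 1 Real.tanh := by
    rw [show Real.tanh = fun t ↦ Real.sinh t / Real.cosh t from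
      funext Real.tanh_eq_sinh_div_cosh]
    exact Real.contDiff_sinh.div Real.contDiff_cosh fun t ↦ (Real.cosh_pos t).ne'
  have hF (a b : ℂ) : ContDiffOn ℝ 1 (hyp2F1 a b (α + 1)) (Metric.ball 0 1) := by
    refine ContDiffOn.restrict_scalars ℝ (𝕜' := ℂ) (DifferentiableOn.contDiffOn
      (fun z hz ↦ ?_) Metric.isOpen_ball)
    have := hasDerivAt_tsum_mul_pow (fun r ↦ summable_hypCoeff a b hc (r := r))
      (mem_ball_zero_iff.1 hz)
    exact this.differentiableAt.differentiableWithinAt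
  refine ContDiff.mul ?_ ((hF _ _).comp_contDiff (f := fun t ↦ (Real.tanh t : ℂ) ^ 2)
    ((Complex.ofRealCLM.contDiff.comp hT).pow 2) fun t ↦ ?_)
  · exact (contDiff_const.mul (Complex.ofRealCLM.contDiff.comp
      (Real.contDiff_cosh.log fun t ↦ (Real.cosh_pos t).ne'))).cexp
  · simpa [← Complex.ofReal_pow, -Complex.ofReal_tanh] using Real.abs_tanh_lt_one t

theorem hasDerivAt_jacobiWeight (α β : ℝ) {t : ℝ} (ht : 0 < t) :
    HasDerivAt (jacobiWeight α β) (jacobiWeight α β t *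
      ((2 * α + 1) / Real.tanh t + (2 * β + 1) * Real.tanh t)) t := by
  have hS := Real.sinh_pos_iff.2 ht
  have hC := Real.cosh_pos t
  refine ((((Real.hasDerivAt_sinh t).const_mul 2).rpow_const (p := 2 * α + 1)
    (.inl (by positivity))).mul (((Real.hasDerivAt_cosh t).const_mul 2).rpow_const
    (p := 2 * β + 1) (.inl (by positivity)))).congr_deriv ?_
  rw [Real.rpow_sub_one (by positivity), Real.rpow_sub_one (by positivity), jacobiWeight,
    Real.tanh_eq_sinh_div_cosh]
  field_simp

theorem continuous_jacobiWeight {α : ℝ} (β : ℝ) (hα : -(1 / 2 : ℝ) < α) :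
    Continuous (jacobiWeight α β) :=
  ((Real.continuous_sinh.const_mul 2).rpow_const fun _ ↦ .inr (by linarith)).mul
    ((Real.continuous_cosh.const_mul 2).rpow_const fun t ↦
      .inl (by have := Real.cosh_pos t; positivity))

theorem jacobiWeight_zero {α : ℝ} (β : ℝ) (hα : -(1 / 2 : ℝ) < α) : jacobiWeight α β 0 = 0 := by
  simp [jacobiWeight, Real.zero_rpow (show 2 * α + 1 ≠ 0 by linarith)]

/-- The Jacobi function is an eigenfunction of the Jacobi operator. -/
theorem hasDerivAt_jacobiWeight_mul_deriv_jacobiPhi {α : ℝ} (β : ℝ) (hα : -(1 / 2 : ℝ) < α)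
    (l : ℂ) {t : ℝ} (ht : 0 < t) :
    HasDerivAt (fun s ↦ (jacobiWeight α β s : ℂ) * deriv (jacobiPhi α β l) s)
      (-(l ^ 2 + (α + β + 1) ^ 2) * jacobiWeight α β t * jacobiPhi α β l t) t := by
  have hc (n : ℕ) : (α : ℂ) + 1 + n ≠ 0 := by
    have : 0 < α + 1 + n := by have := n.cast_nonneg (α := ℝ); linarith
    exact_mod_cast this.ne'
  have hT₀ {s : ℝ} (hs : 0 < s) : (Real.tanh s : ℂ) ≠ 0 := by
    rw [Real.tanh_eq_sinh_div_cosh]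
    exact_mod_cast (div_pos (Real.sinh_pos_iff.2 hs) (Real.cosh_pos s)).ne'
  have hz (s : ℝ) : ‖(Real.tanh s : ℂ) ^ 2‖ < 1 := by
    simpa [← Complex.ofReal_pow, -Complex.ofReal_tanh] using Real.abs_tanh_lt_one s
  have hT (s : ℝ) : HasDerivAt (fun s ↦ (Real.tanh s : ℂ)) (1 - (Real.tanh s : ℂ) ^ 2) s := by
    simpa [-Complex.ofReal_tanh] using (hasDerivAt_real_tanh s).ofReal_comp
  set a : ℂ := ((α : ℂ) + β + 1 + Complex.I * l) / 2 with ha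
  set b : ℂ := ((α : ℂ) - β + 1 + Complex.I * l) / 2 with hb
  have hΘ (k : ℕ) {s : ℝ} (hs : 0 < s) :
      HasDerivAt (fun s ↦ hypTheta a b (α + 1) k ((Real.tanh s : ℂ) ^ 2))
        (2 * hypTheta a b (α + 1) (k + 1) ((Real.tanh s : ℂ) ^ 2) *
          (1 - (Real.tanh s : ℂ) ^ 2) / Real.tanh s) s := by
    have h₀ := hT₀ hs
    refine ((hasDerivAt_hypTheta a b hc k (hz s) (pow_ne_zero 2 h₀)).comp s
      ((hT s).pow 2)).congr_deriv ?_
    field_simp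
    ring
  set e : ℝ → ℂ := fun s ↦ Complex.exp
    ((-(α : ℂ) - (β : ℂ) - 1 - Complex.I * l) * (Real.log (Real.cosh s) : ℂ)) with he
  have he' (s : ℝ) : HasDerivAt e (-(2 * a) * Real.tanh s * e s) s := by
    have h := (((Real.hasDerivAt_cosh s).log (Real.cosh_pos s).ne').ofReal_comp.const_mul
      (-(α : ℂ) - (β : ℂ) - 1 - Complex.I * l)).cexp
    refine h.congr_deriv ?_
    rw [← Real.tanh_eq_sinh_div_cosh, ha, he]
    ring
  have hφ : jacobiPhi α β l = fun s ↦ e s * hypTheta a b (α + 1) 0 ((Real.tanh s : ℂ) ^ 2) := by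
    funext s
    rw [hypTheta_zero, jacobiPhi]
  have hφ' {s : ℝ} (hs : 0 < s) := (he' s).mul (hΘ 0 hs)
  have hd := (he' t).mul ((((hT t).const_mul (-(2 * a))).mul (hΘ 0 ht)).add
    ((((hΘ 1 ht).const_mul 2).mul (((hT t).pow 2).const_sub 1)).div (hT t) (hT₀ ht)))
  have hev : deriv (jacobiPhi α β l) =ᶠ[𝓝 t] fun s ↦ e s *
      (-(2 * a) * Real.tanh s * hypTheta a b (α + 1) 0 ((Real.tanh s : ℂ) ^ 2) +
        2 * hypTheta a b (α + 1) 1 ((Real.tanh s : ℂ) ^ 2) *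
          (1 - (Real.tanh s : ℂ) ^ 2) / Real.tanh s) := by
    filter_upwards [lt_mem_nhds ht] with s hs
    rw [hφ]
    refine (hφ' hs).deriv.trans ?_
    ring
  refine ((hasDerivAt_jacobiWeight α β ht).ofReal_comp.mul
    (hd.congr_of_eventuallyEq hev)).congr_deriv ?_
  have hode := hypTheta_differential_equation a b hc (hz t)
  rw [hev.eq_of_nhds, hφ]
  have h₀ := hT₀ ht
  have hI := Complex.I_sq
  have hbe : b = a - β := by rw [ha, hb]; ring
  have hl : l ^ 2 = -(2 * a - (α + β + 1)) ^ 2 := by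
    rw [ha]; linear_combination l ^ 2 * hI
  rw [hl]
  simp only [Pi.mul_apply, Pi.add_apply, Pi.div_apply, Pi.pow_apply]
  push_cast [-Complex.ofReal_tanh]
  generalize hypTheta a b (α + 1) 0 _ = F at *
  generalize hypTheta a b (α + 1) 1 _ = G at *
  generalize hypTheta a b (α + 1) 2 _ = H at *
  generalize (Real.tanh t : ℂ) = T at *
  rw [hbe] at hode
  generalize (jacobiWeight α β t : ℂ) = W at *
  linear_combination (norm := (field_simp; ring)) (4 * W * e t * (1 - T ^ 2) / T ^ 2) * hode

/-- Green-type identity for Jacobi functions: for `α > −1/2`, `x > 0`, `λ² ≠ μ²`,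
`∫₀ˣ φ_λ φ_μ Δ dt = (μ²−λ²)⁻¹ Δ(x) (φ_λ′(x) φ_μ(x) − φ_λ(x) φ_μ′(x))`. -/
theorem stmt13 (α β : ℝ) (hα : -(1/2 : ℝ) < α) (x : ℝ) (hx : 0 < x)
    (l m : ℂ) (hlm : l ^ 2 ≠ m ^ 2) :
    ∫ t in (0:ℝ)..x, jacobiPhi α β l t * jacobiPhi α β m t * (jacobiWeight α β t : ℂ) =
      (m ^ 2 - l ^ 2)⁻¹ * (jacobiWeight α β x : ℂ) *
        (deriv (jacobiPhi α β l) x * jacobiPhi α β m x -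
          jacobiPhi α β l x * deriv (jacobiPhi α β m) x) := by
  have hlm' : m ^ 2 - l ^ 2 ≠ 0 := sub_ne_zero.2 hlm.symm
  have hW := Complex.continuous_ofReal.comp (continuous_jacobiWeight β hα)
  have hφ (l : ℂ) := contDiff_jacobiPhi β hα l
  have hφ' (l : ℂ) := (hφ l).continuous_deriv le_rfl
  have key := intervalIntegral.integral_eq_sub_of_hasDerivAt_of_le hx.le
    (f := fun t ↦ jacobiWeight α β t * deriv (jacobiPhi α β l) t * jacobiPhi α β m t -
      jacobiPhi α β l t * (jacobiWeight α β t * deriv (jacobiPhi α β m) t))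
    (f' := fun t ↦ (m ^ 2 - l ^ 2) *
      (jacobiPhi α β l t * jacobiPhi α β m t * (jacobiWeight α β t : ℂ)))
    (((hW.mul (hφ' l)).mul (hφ m).continuous).sub
      ((hφ l).continuous.mul (hW.mul (hφ' m)))).continuousOn
    (fun t ht ↦ ?_)
    ((((hφ l).continuous.mul (hφ m).continuous).mul hW).const_mul _ |>.intervalIntegrable _ _)
  · rw [intervalIntegral.integral_const_mul, jacobiWeight_zero β hα] at key
    rw [mul_assoc, eq_inv_mul_iff_mul_eq₀ hlm', key]
    push_cast
    ring
  · have hd (k : ℂ) := hasDerivAt_jacobiWeight_mul_deriv_jacobiPhi β hα k ht.1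
    have hφd (k : ℂ) := ((hφ k).differentiable one_ne_zero t).hasDerivAt
    refine (((hd l).mul (hφd m)).sub ((hφd l).mul (hd m))).congr_deriv ?_
    ring
end

section
/- For every continuous function f : ℝ → ℝ, (2π)^{−2} ∫_{[0,2π]²} f(4cos θ₁ cos θ₂) dθ₁dθ₂ = ∫_{−4}^{4} f(x) · (1/(4π)) · ₂F₁(1/2, 1/2; 1; 1 − x²/16) dx. (Equivalently, the probability density on (−4,4) of the product (X₁+X₁⁻¹)(X₂+X₂⁻¹) of two independent uniform points on the complex unit circle is p̂₂(x) = (1/(4π)) ₂F₁(1/2, 1/2; 1; 1 − x²/16).) -/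
open MeasureTheory Real

/-- Pochhammer symbol `(x)ₙ = x (x+1) ⋯ (x+n-1)` in `ℝ`. -/
noncomputable def pochR (x : ℝ) (n : ℕ) : ℝ := (ascPochhammer ℝ n).eval x

/-- The Gauss hypergeometric series `₂F₁(a,b;c;z)` over `ℝ`. -/
noncomputable def hyp2F1R (a b c z : ℝ) : ℝ :=
  ∑' n : ℕ, pochR a n * pochR b n / (pochR c n * (n.factorial : ℝ)) * z ^ n

open Filter Topology

/-- The coefficients `(1/2)ₙ² / n!²` of `₂F₁(1/2,1/2;1;z)`. -/
noncomputable def halfCoeff (n : ℕ) : ℝ :=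
  pochR (1/2) n * pochR (1/2) n / (pochR 1 n * (n.factorial : ℝ))

/-- The moments of the symmetric Jacobi weights `(1 - u²)ⁿ` on `[-1, 1]`. -/
noncomputable def jacobiMoment (n k : ℕ) : ℝ := ∫ u in (-1 : ℝ)..1, u ^ k * (1 - u ^ 2) ^ n

lemma halfCoeff_zero : halfCoeff 0 = 1 := by simp [halfCoeff, pochR]

lemma halfCoeff_succ (n : ℕ) :
    halfCoeff (n + 1) = halfCoeff n * ((2 * n + 1) / (2 * n + 2)) ^ 2 := by
  have h : (n.factorial : ℝ) ≠ 0 := by positivity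
  have h' : (n : ℝ) + 1 ≠ 0 := by positivity
  simp only [halfCoeff, pochR, ascPochhammer_eval_one]
  rw [ascPochhammer_succ_eval, Nat.factorial_succ]
  push_cast
  field_simp
  ring

lemma halfCoeff_pos (n : ℕ) : 0 < halfCoeff n := by
  induction n with
  | zero => simp [halfCoeff_zero]
  | succ n ih => rw [halfCoeff_succ]; positivity

lemma wallis_mul_halfCoeff (n : ℕ) : Real.Wallis.W n * ((2 * n + 1) * halfCoeff n) = 1 := by
  induction n with
  | zero => simp [halfCoeff_zero, Real.Wallis.W]
  | succ n ih =>
    rw [Real.Wallis.W_succ, halfCoeff_succ]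
    refine Eq.trans ?_ ih
    push_cast
    rw [show 2 * ((n : ℝ) + 1) + 1 = 2 * n + 3 by ring]
    field_simp

lemma natCast_mul_halfCoeff_le (n : ℕ) : (2 * n + 1) * halfCoeff n ≤ 1 := by
  induction n with
  | zero => simp [halfCoeff_zero]
  | succ n ih =>
    refine le_trans ?_ ih
    rw [halfCoeff_succ]
    have : (2 * ((n + 1 : ℕ) : ℝ) + 1) * (halfCoeff n * ((2 * n + 1) / (2 * n + 2)) ^ 2) =
        (2 * n + 1) * halfCoeff n * ((2 * n + 3) * (2 * n + 1) / (2 * n + 2) ^ 2) := by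
      push_cast; field_simp; ring
    rw [this]
    refine mul_le_of_le_one_right (by have := halfCoeff_pos n; positivity) ?_
    rw [div_le_one (by positivity)]
    nlinarith

lemma intervalIntegrable_mul_one_sub_sq_pow {g : ℝ → ℝ} (hg : Continuous g) (n : ℕ) :
    IntervalIntegrable (fun u : ℝ => g u * (1 - u ^ 2) ^ n) volume (-1) 1 :=
  (by fun_prop : Continuous fun u : ℝ => g u * (1 - u ^ 2) ^ n).intervalIntegrable _ _

lemma jacobiMoment_intervalIntegrable (n k : ℕ) :
    IntervalIntegrable (fun u : ℝ => u ^ k * (1 - u ^ 2) ^ n) volume (-1) 1 :=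
  intervalIntegrable_mul_one_sub_sq_pow (continuous_pow k) n

lemma jacobiMoment_succ_left_eq_sub (n k : ℕ) :
    jacobiMoment (n + 1) k = jacobiMoment n k - jacobiMoment n (k + 2) := by
  rw [jacobiMoment, jacobiMoment, jacobiMoment, ← intervalIntegral.integral_sub
    (jacobiMoment_intervalIntegrable _ _) (jacobiMoment_intervalIntegrable _ _)]
  congr 1; ext u; ring

lemma jacobiMoment_add_two_right (n k : ℕ) :
    jacobiMoment n (k + 2) = (k + 1) / (2 * n + k + 3) * jacobiMoment n k := by
  have hderiv : ∀ u : ℝ, HasDerivAt (fun u : ℝ => u ^ (k + 1) * (1 - u ^ 2) ^ (n + 1))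
      ((k + 1) * (u ^ k * (1 - u ^ 2) ^ (n + 1)) -
        2 * (n + 1) * (u ^ (k + 2) * (1 - u ^ 2) ^ n)) u := by
    intro u
    refine ((hasDerivAt_pow (k + 1) u).mul
      (((hasDerivAt_pow 2 u).const_sub 1).pow (n + 1))).congr_deriv ?_
    push_cast
    simp only [Pi.pow_apply]
    ring
  have hint := intervalIntegral.integral_eq_sub_of_hasDerivAt (a := -1) (b := 1)
    (fun u _ => hderiv u) ((by fun_prop : Continuous _).intervalIntegrable _ _)
  rw [intervalIntegral.integral_sub ((jacobiMoment_intervalIntegrable _ _).const_mul _)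
    ((jacobiMoment_intervalIntegrable _ _).const_mul _), intervalIntegral.integral_const_mul,
    intervalIntegral.integral_const_mul] at hint
  change (k + 1) * jacobiMoment (n + 1) k - 2 * (n + 1) * jacobiMoment n (k + 2) = _ at hint
  rw [jacobiMoment_succ_left_eq_sub] at hint
  norm_num at hint
  have : (2 * n + k + 3 : ℝ) ≠ 0 := by positivity
  field_simp
  linarith

lemma jacobiMoment_succ_left (n k : ℕ) :
    jacobiMoment (n + 1) k = (2 * n + 2) / (2 * n + k + 3) * jacobiMoment n k := by
  rw [jacobiMoment_succ_left_eq_sub, jacobiMoment_add_two_right]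
  have : (2 * n + k + 3 : ℝ) ≠ 0 := by positivity
  field_simp
  ring

lemma jacobiMoment_zero_left (m : ℕ) : jacobiMoment 0 (2 * m) = 2 / (2 * m + 1) := by
  simp [jacobiMoment, integral_pow]
  norm_num [pow_succ, pow_mul]

lemma jacobiMoment_one_right (n : ℕ) : jacobiMoment n 1 = 0 := by
  induction n with
  | zero => simp [jacobiMoment]
  | succ n ih => rw [jacobiMoment_succ_left, ih, mul_zero]

lemma one_sub_sq_pow_nonneg {u : ℝ} (hu : u ∈ Set.Icc (-1 : ℝ) 1) (n : ℕ) :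
    0 ≤ (1 - u ^ 2) ^ n :=
  pow_nonneg (by nlinarith [hu.1, hu.2]) n

lemma abs_integral_mul_one_sub_sq_pow_le {g : ℝ → ℝ} {C : ℝ}
    (hg : ∀ u ∈ Set.Icc (-1 : ℝ) 1, |g u| ≤ C) (n : ℕ) :
    |∫ u in (-1 : ℝ)..1, g u * (1 - u ^ 2) ^ n| ≤ C * jacobiMoment n 0 := by
  rw [jacobiMoment, ← intervalIntegral.integral_const_mul, ← Real.norm_eq_abs]
  refine intervalIntegral.norm_integral_le_of_norm_le (by norm_num) ?_
    ((jacobiMoment_intervalIntegrable n 0).const_mul C)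
  filter_upwards with u hu
  have hu' := Set.Ioc_subset_Icc_self hu
  have h := one_sub_sq_pow_nonneg hu' n
  rw [norm_mul, Real.norm_eq_abs, Real.norm_of_nonneg h, pow_zero, one_mul]
  exact mul_le_mul_of_nonneg_right (hg u hu') h

lemma abs_jacobiMoment_le (n k : ℕ) : |jacobiMoment n k| ≤ jacobiMoment n 0 := by
  simpa [jacobiMoment] using abs_integral_mul_one_sub_sq_pow_le (g := fun u => u ^ k) (C := 1)
    (fun u hu => by rw [abs_pow]; exact pow_le_one₀ (abs_nonneg _) (abs_le.2 hu)) n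

lemma jacobiMoment_zero_right_nonneg (n : ℕ) : 0 ≤ jacobiMoment n 0 :=
  (abs_nonneg _).trans (abs_jacobiMoment_le n 0)

lemma sq_jacobiMoment_zero_right_le (n : ℕ) : jacobiMoment n 0 ^ 2 ≤ 4 / (n + 1) := by
  induction n with
  | zero => have := jacobiMoment_zero_left 0; norm_num at this; norm_num [this]
  | succ n ih =>
    rw [jacobiMoment_succ_left, mul_pow]
    refine (mul_le_mul_of_nonneg_left ih (sq_nonneg _)).trans ?_
    push_cast
    rw [div_pow, div_mul_div_comm, div_le_div_iff₀ (by positivity) (by positivity)]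
    nlinarith [sq_nonneg (n : ℝ)]

lemma tendsto_jacobiMoment (k : ℕ) : Tendsto (fun n => jacobiMoment n k) atTop (𝓝 0) := by
  have hsq : Tendsto (fun n => jacobiMoment n 0 ^ 2) atTop (𝓝 0) := by
    refine squeeze_zero (fun n => sq_nonneg _) sq_jacobiMoment_zero_right_le ?_
    simpa [div_eq_mul_inv] using
      (tendsto_one_div_add_atTop_nhds_zero_nat (𝕜 := ℝ)).const_mul 4
  have h := hsq.sqrt
  simp only [Real.sqrt_sq (jacobiMoment_zero_right_nonneg _), Real.sqrt_zero] at h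
  exact squeeze_zero_norm (fun n => abs_jacobiMoment_le n k) h

/-- Creative telescoping for the summand `halfCoeff n * jacobiMoment n k`. -/
lemma halfCoeff_mul_jacobiMoment_telescope (n k : ℕ) :
    halfCoeff n * ((k + 2) ^ 2 * jacobiMoment n (k + 2) - (k + 1) ^ 2 * jacobiMoment n k) =
      2 * (k + 1) * (n + 1 : ℕ) * (halfCoeff (n + 1) * jacobiMoment (n + 1) k) -
        2 * (k + 1) * n * (halfCoeff n * jacobiMoment n k) := by
  rw [halfCoeff_succ, jacobiMoment_succ_left, jacobiMoment_add_two_right]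
  have : (2 * n + k + 3 : ℝ) ≠ 0 := by positivity
  push_cast
  field_simp
  ring

lemma summable_halfCoeff_mul_jacobiMoment_zero :
    Summable fun n => halfCoeff n * jacobiMoment n 0 := by
  have hnonneg : ∀ n, 0 ≤ halfCoeff n * jacobiMoment n 0 := fun n =>
    mul_nonneg (halfCoeff_pos n).le (jacobiMoment_zero_right_nonneg n)
  have hJ : jacobiMoment 0 0 = 2 := by simpa using jacobiMoment_zero_left 0
  have key : ∀ N : ℕ, ∑ n ∈ Finset.range (N + 1), halfCoeff n * jacobiMoment n 0 +
      10 * (N + 1 : ℕ) * (halfCoeff (N + 1) * jacobiMoment (N + 1) 0) ≤ 6 := by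
    intro N
    induction N with
    | zero =>
      simp only [Finset.sum_range_succ, Finset.sum_range_zero, halfCoeff_succ, halfCoeff_zero,
        jacobiMoment_succ_left, hJ]
      norm_num
    | succ N ih =>
      rw [Finset.sum_range_succ]
      have ht := halfCoeff_mul_jacobiMoment_telescope (N + 1) 0
      rw [jacobiMoment_add_two_right] at ht
      have hfrac : (((0 : ℕ) : ℝ) + 1) / (2 * ((N + 1 : ℕ) : ℝ) + (0 : ℕ) + 3) ≤ 1 / 5 := by
        push_cast
        rw [div_le_div_iff₀ (by positivity) (by norm_num)]
        linarith [(Nat.cast_nonneg N : (0 : ℝ) ≤ N)]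
      have := mul_le_mul_of_nonneg_right hfrac (hnonneg (N + 1))
      push_cast at *
      linarith
  refine summable_of_sum_range_le (c := 6) hnonneg fun N => ?_
  have h1 := key N
  rw [Finset.sum_range_succ] at h1
  have h2 := hnonneg N
  have h3 : 0 ≤ 10 * ((N + 1 : ℕ) : ℝ) * (halfCoeff (N + 1) * jacobiMoment (N + 1) 0) :=
    mul_nonneg (by positivity) (hnonneg _)
  linarith

lemma summable_halfCoeff_mul_integral {g : ℝ → ℝ} {C : ℝ}
    (hg : ∀ u ∈ Set.Icc (-1 : ℝ) 1, |g u| ≤ C) :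
    Summable fun n => halfCoeff n * ∫ u in (-1 : ℝ)..1, g u * (1 - u ^ 2) ^ n := by
  refine (summable_halfCoeff_mul_jacobiMoment_zero.mul_left C).of_norm_bounded fun n => ?_
  rw [norm_mul, Real.norm_of_nonneg (halfCoeff_pos n).le, Real.norm_eq_abs, mul_left_comm]
  exact mul_le_mul_of_nonneg_left (abs_integral_mul_one_sub_sq_pow_le hg n) (halfCoeff_pos n).le

lemma summable_halfCoeff_mul_jacobiMoment (k : ℕ) :
    Summable fun n => halfCoeff n * jacobiMoment n k :=
  summable_halfCoeff_mul_integral (g := fun u => u ^ k) (C := 1)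
    (fun u hu => by rw [abs_pow]; exact pow_le_one₀ (abs_nonneg _) (abs_le.2 hu))

lemma tsum_halfCoeff_mul_jacobiMoment_add_two (k : ℕ) :
    (k + 2) ^ 2 * ∑' n, halfCoeff n * jacobiMoment n (k + 2) =
      (k + 1) ^ 2 * ∑' n, halfCoeff n * jacobiMoment n k := by
  have hsum := (((summable_halfCoeff_mul_jacobiMoment (k + 2)).hasSum.mul_left
    (((k : ℝ) + 2) ^ 2)).sub ((summable_halfCoeff_mul_jacobiMoment k).hasSum.mul_left
    (((k : ℝ) + 1) ^ 2))).tendsto_sum_nat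
  have hlim : Tendsto (fun N : ℕ => 2 * ((k : ℝ) + 1) * N * (halfCoeff N * jacobiMoment N k))
      atTop (𝓝 0) := by
    refine squeeze_zero_norm (a := fun N => ((k : ℝ) + 1) * |jacobiMoment N k|) (fun N => ?_) ?_
    · have h1 := natCast_mul_halfCoeff_le N
      have h2 := halfCoeff_pos N
      have h3 : |2 * ((k : ℝ) + 1) * N * (halfCoeff N * jacobiMoment N k)| =
          (k + 1) * ((2 * N * halfCoeff N) * |jacobiMoment N k|) := by
        rw [abs_mul, abs_mul (halfCoeff N), abs_of_pos h2, abs_of_nonneg (by positivity)]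
        ring
      rw [Real.norm_eq_abs, h3]
      refine mul_le_mul_of_nonneg_left ?_ (by positivity)
      exact mul_le_of_le_one_left (abs_nonneg _) (by linarith)
    · simpa using ((tendsto_jacobiMoment k).abs).const_mul ((k : ℝ) + 1)
  have heq : ∀ N : ℕ, ∑ n ∈ Finset.range N, (((k : ℝ) + 2) ^ 2 *
      (halfCoeff n * jacobiMoment n (k + 2)) - ((k : ℝ) + 1) ^ 2 *
      (halfCoeff n * jacobiMoment n k)) =
      2 * ((k : ℝ) + 1) * N * (halfCoeff N * jacobiMoment N k) := by
    intro N
    induction N with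
    | zero => simp
    | succ N ih =>
      rw [Finset.sum_range_succ, ih]
      linarith [halfCoeff_mul_jacobiMoment_telescope N k]
  simp only [heq] at hsum
  exact sub_eq_zero.1 (tendsto_nhds_unique hsum hlim)

lemma tsum_halfCoeff_mul_jacobiMoment_two_mul (m : ℕ) :
    ∑' n, halfCoeff n * jacobiMoment n (2 * m) =
      halfCoeff m * ∑' n, halfCoeff n * jacobiMoment n 0 := by
  induction m with
  | zero => simp [halfCoeff_zero]
  | succ m ih =>
    have h := tsum_halfCoeff_mul_jacobiMoment_add_two (2 * m)
    rw [ih] at h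
    rw [halfCoeff_succ, mul_add_one]
    push_cast at h
    field_simp
    linarith

lemma add_one_mul_jacobiMoment_two_mul_mem (n m : ℕ) :
    (2 * m + 1) * jacobiMoment n (2 * m) ∈ Set.Icc 0 (jacobiMoment n 0) := by
  induction n with
  | zero =>
    have := jacobiMoment_zero_left 0
    simp only [mul_zero] at this
    rw [jacobiMoment_zero_left, this, mul_div_cancel₀ _ (by positivity)]
    norm_num
  | succ n ih =>
    rw [jacobiMoment_succ_left, jacobiMoment_succ_left, mul_left_comm]
    refine ⟨mul_nonneg (by positivity) ih.1, mul_le_mul ?_ ih.2 ih.1 (by positivity)⟩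
    push_cast
    gcongr
    simp

lemma tendsto_add_one_mul_jacobiMoment_two_mul (n : ℕ) :
    Tendsto (fun m : ℕ => (2 * m + 1) * jacobiMoment n (2 * m)) atTop
      (𝓝 (if n = 0 then 2 else 0)) := by
  cases n with
  | zero =>
    simp only [jacobiMoment_zero_left, if_true]
    refine tendsto_const_nhds.congr fun m => ?_
    rw [mul_div_cancel₀ _ (by positivity)]
  | succ n =>
    simp only [Nat.succ_ne_zero, if_false]
    refine squeeze_zero (fun m => (add_one_mul_jacobiMoment_two_mul_mem (n + 1) m).1)
      (g := fun m : ℕ => ((2 * n + 2) * jacobiMoment n 0) * (1 / ((m : ℝ) + 1))) (fun m => ?_) ?_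
    · have h := add_one_mul_jacobiMoment_two_mul_mem n m
      rw [jacobiMoment_succ_left, mul_left_comm]
      calc _ ≤ (2 * n + 2) / (2 * n + (2 * m : ℕ) + 3) * jacobiMoment n 0 :=
            mul_le_mul_of_nonneg_left h.2 (by positivity)
        _ ≤ (2 * n + 2) / (m + 1) * jacobiMoment n 0 := by
            refine mul_le_mul_of_nonneg_right ?_ (jacobiMoment_zero_right_nonneg n)
            push_cast
            refine div_le_div_of_nonneg_left (by positivity) (by positivity) ?_
            linarith [(Nat.cast_nonneg n : (0 : ℝ) ≤ n), (Nat.cast_nonneg m : (0 : ℝ) ≤ m)]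
        _ = _ := by ring
    · simpa using (tendsto_one_div_add_atTop_nhds_zero_nat (𝕜 := ℝ)).const_mul
        ((2 * n + 2) * jacobiMoment n 0)

lemma tsum_halfCoeff_mul_jacobiMoment_zero : ∑' n, halfCoeff n * jacobiMoment n 0 = π := by
  set S := ∑' n, halfCoeff n * jacobiMoment n 0 with hS
  have h1 : Tendsto (fun m : ℕ => ∑' n, halfCoeff n * ((2 * m + 1) * jacobiMoment n (2 * m)))
      atTop (𝓝 (∑' n, halfCoeff n * (if n = 0 then 2 else 0))) := by
    refine tendsto_tsum_of_dominated_convergence summable_halfCoeff_mul_jacobiMoment_zero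
      (fun n => (tendsto_add_one_mul_jacobiMoment_two_mul n).const_mul _)
      (Eventually.of_forall fun m n => ?_)
    have h := add_one_mul_jacobiMoment_two_mul_mem n m
    rw [Real.norm_of_nonneg (mul_nonneg (halfCoeff_pos n).le h.1)]
    exact mul_le_mul_of_nonneg_left h.2 (halfCoeff_pos n).le
  have h2 : Tendsto (fun m : ℕ => ∑' n, halfCoeff n * ((2 * m + 1) * jacobiMoment n (2 * m)))
      atTop (𝓝 ((π / 2)⁻¹ * S)) := by
    refine ((Real.Wallis.tendsto_W_nhds_pi_div_two.inv₀ (by positivity)).mul_const S).congr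
      fun m => ?_
    simp only [mul_left_comm (halfCoeff _)]
    rw [tsum_mul_left, tsum_halfCoeff_mul_jacobiMoment_two_mul, ← mul_assoc,
      inv_eq_of_mul_eq_one_right (wallis_mul_halfCoeff m)]
  have h3 := tendsto_nhds_unique h1 h2
  rw [tsum_eq_single 0 (fun n hn => by simp [hn])] at h3
  simp only [halfCoeff_zero, if_true] at h3
  field_simp at h3
  linarith

lemma tsum_halfCoeff_mul_jacobiMoment (k : ℕ) :
    ∑' n, halfCoeff n * jacobiMoment n k =
      π * ((2 * π)⁻¹ * ∫ t in (0 : ℝ)..2 * π, Real.cos t ^ k) ^ 2 := by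
  induction k using Nat.twoStepInduction with
  | zero => simp [tsum_halfCoeff_mul_jacobiMoment_zero, -mul_inv_rev]
  | one => simp [jacobiMoment_one_right]
  | more k ih _ =>
    have h := tsum_halfCoeff_mul_jacobiMoment_add_two k
    rw [ih] at h
    rw [integral_cos_pow]
    simp only [Real.sin_two_pi, Real.sin_zero, mul_zero, sub_zero, zero_div, zero_add]
    have : ((k : ℝ) + 2) ≠ 0 := by positivity
    rw [← mul_right_inj' (pow_ne_zero 2 this), h]
    field_simp

lemma integral_mul_hyp2F1R_half {g : ℝ → ℝ} (hg : Continuous g) :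
    ∫ u in (-1 : ℝ)..1, g u * hyp2F1R (1/2) (1/2) 1 (1 - u ^ 2) =
      ∑' n, halfCoeff n * ∫ u in (-1 : ℝ)..1, g u * (1 - u ^ 2) ^ n := by
  obtain ⟨C, hC⟩ := isCompact_Icc.exists_bound_of_continuousOn
    (hg.continuousOn (s := Set.Icc (-1 : ℝ) 1))
  have hle : (-1 : ℝ) ≤ 1 := by norm_num
  have h := hasSum_integral_of_summable_integral_norm
    (μ := volume.restrict (Set.Ioc (-1 : ℝ) 1))
    (F := fun n u => halfCoeff n * (g u * (1 - u ^ 2) ^ n)) (fun n => ?_) ?_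
  · simp only [intervalIntegral.integral_of_le hle, ← integral_const_mul]
    rw [h.tsum_eq]
    congr 1; ext u
    rw [hyp2F1R, ← tsum_mul_left]
    congr 1; ext n
    rw [halfCoeff]
    ring
  · exact (by fun_prop : Continuous fun u => halfCoeff n * (g u * (1 - u ^ 2) ^ n)).integrableOn_Ioc
  · refine (summable_halfCoeff_mul_integral (g := fun u => |g u|) (C := C)
      (fun u hu => by simpa using hC u hu)).congr fun n => ?_
    rw [intervalIntegral.integral_of_le hle, ← integral_const_mul]
    refine setIntegral_congr_fun measurableSet_Ioc fun u hu => ?_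
    simp only [norm_mul, Real.norm_of_nonneg (halfCoeff_pos n).le,
      Real.norm_of_nonneg (one_sub_sq_pow_nonneg (Set.Ioc_subset_Icc_self hu) n),
      Real.norm_eq_abs]

/-- The square `[0, 2π]²` of angles. -/
def angleSquare : Set (Fin 2 → ℝ) := Set.univ.pi fun _ => Set.Icc 0 (2 * π)

lemma isCompact_angleSquare : IsCompact angleSquare := isCompact_univ_pi fun _ => isCompact_Icc

lemma measureReal_angleSquare : volume.real angleSquare = (2 * π) ^ 2 := by
  rw [Measure.real, angleSquare, Set.pi_univ_Icc,
    Real.volume_Icc_pi_toReal fun _ => by positivity]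
  simp

lemma integrableOn_angleSquare {g : ℝ → ℝ} (hg : Continuous g) :
    IntegrableOn (fun θ : Fin 2 → ℝ => g (Real.cos (θ 0) * Real.cos (θ 1))) angleSquare :=
  (by fun_prop : Continuous _).continuousOn.integrableOn_compact isCompact_angleSquare

lemma integral_angleSquare_pow (k : ℕ) :
    ∫ θ in angleSquare, (Real.cos (θ 0) * Real.cos (θ 1)) ^ k =
      (∫ t in (0 : ℝ)..2 * π, Real.cos t ^ k) ^ 2 := by
  have h := integral_fintype_prod_eq_prod (ι := Fin 2) (fun _ t => Real.cos t ^ k)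
    (μ := fun _ => volume.restrict (Set.Icc 0 (2 * π)))
  rw [← Measure.restrict_pi_pi, ← volume_pi] at h
  simp only [Fin.prod_univ_two, ← mul_pow] at h
  rw [angleSquare, h, intervalIntegral.integral_of_le (by positivity), integral_Icc_eq_integral_Ioc,
    sq]

lemma tsum_halfCoeff_mul_integral_polynomial (p : Polynomial ℝ) :
    ∑' n, halfCoeff n * ∫ u in (-1 : ℝ)..1, p.eval u * (1 - u ^ 2) ^ n =
      π * (((2 * π) ^ 2)⁻¹ * ∫ θ in angleSquare, p.eval (Real.cos (θ 0) * Real.cos (θ 1))) := by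
  have hsummable : ∀ q : Polynomial ℝ,
      Summable fun n => halfCoeff n * ∫ u in (-1 : ℝ)..1, q.eval u * (1 - u ^ 2) ^ n := fun q => by
    obtain ⟨C, hC⟩ := isCompact_Icc.exists_bound_of_continuousOn
      (q.continuous.continuousOn (s := Set.Icc (-1 : ℝ) 1))
    exact summable_halfCoeff_mul_integral hC
  induction p using Polynomial.induction_on' with
  | add p q hp hq =>
    simp only [Polynomial.eval_add, add_mul]
    rw [integral_add (integrableOn_angleSquare p.continuous)
      (integrableOn_angleSquare q.continuous), mul_add, mul_add, ← hp, ← hq,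
      ← (hsummable p).tsum_add (hsummable q)]
    congr 1; ext n
    rw [intervalIntegral.integral_add (intervalIntegrable_mul_one_sub_sq_pow p.continuous n)
      (intervalIntegrable_mul_one_sub_sq_pow q.continuous n), mul_add]
  | monomial k c =>
    simp only [Polynomial.eval_monomial, mul_assoc, intervalIntegral.integral_const_mul,
      integral_const_mul, mul_left_comm _ c]
    rw [tsum_mul_left, integral_angleSquare_pow]
    have := tsum_halfCoeff_mul_jacobiMoment k
    simp only [jacobiMoment] at this
    rw [this]
    ring

lemma tsum_halfCoeff_mul_integral {g : ℝ → ℝ} (hg : Continuous g) :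
    ∑' n, halfCoeff n * ∫ u in (-1 : ℝ)..1, g u * (1 - u ^ 2) ^ n =
      π * (((2 * π) ^ 2)⁻¹ * ∫ θ in angleSquare, g (Real.cos (θ 0) * Real.cos (θ 1))) := by
  obtain ⟨C, hC⟩ := isCompact_Icc.exists_bound_of_continuousOn
    (hg.continuousOn (s := Set.Icc (-1 : ℝ) 1))
  refine eq_of_forall_dist_le fun ε hε => ?_
  obtain ⟨p, hp⟩ := exists_polynomial_near_of_continuousOn (-1) 1 g hg.continuousOn
    (ε / (2 * π)) (by positivity)
  obtain ⟨D, hD⟩ := isCompact_Icc.exists_bound_of_continuousOn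
    (p.continuous.continuousOn (s := Set.Icc (-1 : ℝ) 1))
  have hgp : ∀ u ∈ Set.Icc (-1 : ℝ) 1, |g u - p.eval u| ≤ ε / (2 * π) := fun u hu => by
    rw [abs_sub_comm]; exact (hp u hu).le
  have hseries : |∑' n, halfCoeff n * (∫ u in (-1 : ℝ)..1, g u * (1 - u ^ 2) ^ n) -
      ∑' n, halfCoeff n * ∫ u in (-1 : ℝ)..1, p.eval u * (1 - u ^ 2) ^ n| ≤ ε / 2 := by
    rw [← (summable_halfCoeff_mul_integral hC).tsum_sub (summable_halfCoeff_mul_integral hD)]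
    rw [show ε / 2 = ε / (2 * π) * π by field_simp, ← Real.norm_eq_abs]
    refine tsum_of_norm_bounded (g := fun n => ε / (2 * π) * (halfCoeff n * jacobiMoment n 0))
      ?_ fun n => ?_
    · rw [← tsum_halfCoeff_mul_jacobiMoment_zero]
      exact summable_halfCoeff_mul_jacobiMoment_zero.hasSum.mul_left _
    · rw [← mul_sub, ← intervalIntegral.integral_sub
        (intervalIntegrable_mul_one_sub_sq_pow hg n)
        (intervalIntegrable_mul_one_sub_sq_pow p.continuous n), norm_mul,
        Real.norm_of_nonneg (halfCoeff_pos n).le, mul_left_comm]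
      simp only [← sub_mul]
      exact mul_le_mul_of_nonneg_left (abs_integral_mul_one_sub_sq_pow_le hgp n)
        (halfCoeff_pos n).le
  have hangle : |(∫ θ in angleSquare, g (Real.cos (θ 0) * Real.cos (θ 1))) -
      ∫ θ in angleSquare, p.eval (Real.cos (θ 0) * Real.cos (θ 1))| ≤
        ε / (2 * π) * (2 * π) ^ 2 := by
    rw [← integral_sub (integrableOn_angleSquare hg) (integrableOn_angleSquare p.continuous),
      ← measureReal_angleSquare, ← Real.norm_eq_abs]
    refine norm_setIntegral_le_of_norm_le_const isCompact_angleSquare.measure_lt_top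
      fun θ _ => ?_
    refine hgp _ (abs_le.1 ?_)
    rw [abs_mul]
    exact mul_le_one₀ (Real.abs_cos_le_one _) (abs_nonneg _) (Real.abs_cos_le_one _)
  rw [tsum_halfCoeff_mul_integral_polynomial p] at hseries
  rw [Real.dist_eq]
  set I := ∫ θ in angleSquare, g (Real.cos (θ 0) * Real.cos (θ 1))
  set J := ∫ θ in angleSquare, p.eval (Real.cos (θ 0) * Real.cos (θ 1))
  have hscaled : |π * (((2 * π) ^ 2)⁻¹ * J) - π * (((2 * π) ^ 2)⁻¹ * I)| ≤ ε / 2 := by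
    rw [← mul_sub, ← mul_sub, ← mul_assoc, abs_mul, abs_of_nonneg (by positivity), abs_sub_comm]
    refine (mul_le_mul_of_nonneg_left hangle (by positivity)).trans (le_of_eq ?_)
    field_simp
  exact (abs_sub_le _ _ _).trans ((add_le_add hseries hscaled).trans (by linarith))

/-- The density of `(X₁+X₁⁻¹)(X₂+X₂⁻¹)` for two independent uniform points on
the unit circle is `p̂₂(x) = (1/(4π)) ₂F₁(1/2,1/2;1;1−x²/16)` on `(−4,4)`:
for every continuous `f`,
`(2π)⁻² ∫_{[0,2π]²} f(4 cos θ₁ cos θ₂) = ∫_{−4}^4 f(x) p̂₂(x) dx`. -/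
theorem stmt16 (f : ℝ → ℝ) (hf : Continuous f) :
    ((2 * π) ^ 2)⁻¹ *
        (∫ θ : Fin 2 → ℝ in Set.univ.pi fun _ => Set.Icc 0 (2 * π),
          f (4 * Real.cos (θ 0) * Real.cos (θ 1))) =
      ∫ x in (-4 : ℝ)..4,
        f x * ((4 * π)⁻¹ * hyp2F1R (1/2) (1/2) 1 (1 - x ^ 2 / 16)) := by
  have h := tsum_halfCoeff_mul_integral (g := fun u => f (4 * u)) (by fun_prop)
  rw [← integral_mul_hyp2F1R_half (by fun_prop : Continuous fun u => f (4 * u))] at h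
  have hscale := intervalIntegral.mul_integral_comp_mul_left (a := -1) (b := 1)
    (f := fun x => f x * ((4 * π)⁻¹ * hyp2F1R (1/2) (1/2) 1 (1 - x ^ 2 / 16))) 4
  have harg : ∀ u : ℝ, 1 - (4 * u) ^ 2 / 16 = 1 - u ^ 2 := fun u => by ring
  simp only [harg, mul_left_comm (f _), intervalIntegral.integral_const_mul, h] at hscale
  norm_num only at hscale
  simp only [mul_left_comm (f _), intervalIntegral.integral_const_mul, mul_assoc] at hscale ⊢
  rw [← hscale, angleSquare]
  field_simp
end

section
/- Let r ≥ 1 be an integer, let s > 0 be a real number, and let k be a real number with 0 ≤ k < 2^r. Define F_{r,s}(z) := (2π)^{−r} ∫_{[0,2π]^r} (z + ∏_{i=1}^r 2cos θ_i)^s dθ₁⋯dθ_r for real z, where w^s := exp(s·Log w) uses the principal branch of the complex logarithm (so that for w < 0 one has w^s = e^{iπs}|w|^s) and 0^s := 0. Then the complex conjugate of F_{r,s}(−k) equals e^{−iπs} · F_{r,s}(k). -/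
open MeasureTheory Real

/-- Principal power `w ^ s = exp(s · Log w)` with `0 ^ s := 0`. -/
noncomputable def cpowP (w : ℂ) (s : ℂ) : ℂ :=
  if w = 0 then 0 else Complex.exp (s * Complex.log w)

/-- `F_{r,s}(z) = (2π)^{−r} ∫_{[0,2π]^r} (z + ∏ᵢ 2 cos θᵢ)^s dθ₁⋯dθ_r`,
using the principal branch of the complex power. -/
noncomputable def Frs (r : ℕ) (s : ℂ) (z : ℝ) : ℂ :=
  ((2 * π : ℝ) : ℂ)⁻¹ ^ r *
    ∫ θ : Fin r → ℝ in Set.univ.pi fun _ => Set.Icc 0 (2 * π),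
      cpowP (((z : ℂ)) + ∏ i, 2 * Real.cos (θ i)) s

theorem measurable_cpowP (s : ℂ) : Measurable fun w => cpowP w s := by
  unfold cpowP
  exact Measurable.ite (measurableSet_singleton 0) measurable_const (by fun_prop)

/-- For real `w`, conjugating the principal power of `-w` multiplies that of `w` by `e^{-iπs}`. -/
theorem conj_cpowP_neg_ofReal (w s : ℝ) :
    (starRingEnd ℂ) (cpowP (-(w : ℂ)) s) =
      Complex.exp (-(π : ℂ) * Complex.I * s) * cpowP w s := by
  rcases lt_trichotomy w 0 with h | rfl | h
  · obtain ⟨v, rfl⟩ : ∃ v, w = -v := ⟨-w, by ring⟩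
    have hv : 0 < v := by linarith
    have hv' : (v : ℂ) ≠ 0 := by exact_mod_cast hv.ne'
    have hlog : Complex.log (-(v : ℂ)) = Real.log v + π * Complex.I := by
      rw [← Complex.ofReal_neg, Complex.log, Complex.arg_ofReal_of_neg h]
      simp
    simp only [cpowP, Complex.ofReal_neg, neg_neg, neg_eq_zero, hv', if_false, hlog,
      ← Complex.ofReal_log hv.le, ← Complex.exp_conj, ← Complex.exp_add, map_mul,
      Complex.conj_ofReal]
    congr 1
    ring
  · simp [cpowP]
  · have hw' : (w : ℂ) ≠ 0 := by exact_mod_cast h.ne'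
    have hlog : Complex.log (-(w : ℂ)) = Real.log w + π * Complex.I := by
      rw [← Complex.ofReal_neg, Complex.log, Complex.arg_ofReal_of_neg (by linarith)]
      simp
    simp only [cpowP, neg_eq_zero, hw', if_false, hlog,
      ← Complex.ofReal_log h.le, ← Complex.exp_conj, ← Complex.exp_add, map_mul, map_add,
      Complex.conj_ofReal, Complex.conj_I]
    congr 1
    ring

/-- The involution of `[0, 2π]` reflecting each of the halves `[0, π]` and `(π, 2π]`. -/
noncomputable def halfReflect (x : ℝ) : ℝ := if x ≤ π then π - x else 3 * π - x

theorem cos_halfReflect (x : ℝ) : Real.cos (halfReflect x) = -Real.cos x := by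
  unfold halfReflect
  split_ifs
  · exact Real.cos_pi_sub x
  · rw [show 3 * π - x = (π - x) + 2 * π by ring, Real.cos_add_two_pi, Real.cos_pi_sub]

theorem measurable_halfReflect : Measurable halfReflect :=
  Measurable.ite measurableSet_Iic (by fun_prop) (by fun_prop)

theorem measurePreserving_halfReflect :
    MeasurePreserving halfReflect (volume.restrict (Set.Icc 0 (2 * π)))
      (volume.restrict (Set.Icc 0 (2 * π))) := by
  have hπ := Real.pi_pos
  refine ⟨measurable_halfReflect, ?_⟩
  have h1 : (volume.restrict (Set.Icc 0 π)).map halfReflect = volume.restrict (Set.Icc 0 π) := by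
    have h := ((Measure.measurePreserving_sub_left volume π).restrict_preimage
      (measurableSet_Icc (a := 0) (b := π))).map_eq
    rw [Set.preimage_const_sub_Icc, sub_self, sub_zero] at h
    conv_rhs => rw [← h]
    refine Measure.map_congr ?_
    filter_upwards [ae_restrict_mem measurableSet_Icc] with x hx
    simp [halfReflect, hx.2]
  have h2 : (volume.restrict (Set.Ioc π (2 * π))).map halfReflect =
      volume.restrict (Set.Ioc π (2 * π)) := by
    have h := ((Measure.measurePreserving_sub_left volume (3 * π)).restrict_preimage
      (measurableSet_Ico (a := π) (b := 2 * π))).map_eq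
    rw [Set.preimage_const_sub_Ico, show 3 * π - 2 * π = π by ring,
      show 3 * π - π = 2 * π by ring] at h
    conv_rhs => rw [← Measure.restrict_congr_set Ico_ae_eq_Ioc, ← h]
    refine Measure.map_congr ?_
    filter_upwards [ae_restrict_mem measurableSet_Ioc] with x hx
    simp [halfReflect, not_le.2 hx.1]
  rw [← Set.Icc_union_Ioc_eq_Icc hπ.le (by linarith : π ≤ 2 * π),
    Measure.restrict_union
      (Set.disjoint_left.2 fun x hx hx' => absurd hx.2 (not_le.2 hx'.1)) measurableSet_Ioc,
    Measure.map_add _ _ measurable_halfReflect, h1, h2]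

/-- The product of cosines is symmetrically distributed on the cube `[0, 2π]^ι`. -/
theorem integral_cube_prod_cos_neg {ι : Type*} [Fintype ι] [Nonempty ι] {f : ℝ → ℂ}
    (hf : Measurable f) :
    ∫ θ : ι → ℝ in Set.univ.pi fun _ => Set.Icc 0 (2 * π), f (-∏ i, 2 * Real.cos (θ i)) =
      ∫ θ : ι → ℝ in Set.univ.pi fun _ => Set.Icc 0 (2 * π), f (∏ i, 2 * Real.cos (θ i)) := by
  classical
  obtain ⟨j⟩ := ‹Nonempty ι›
  let g : ι → ℝ → ℝ := fun i => if i = j then halfReflect else id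
  have hg : ∀ i, MeasurePreserving (g i) (volume.restrict (Set.Icc 0 (2 * π)))
      (volume.restrict (Set.Icc 0 (2 * π))) := by
    intro i
    by_cases h : i = j
    · simpa [g, h] using measurePreserving_halfReflect
    · simpa [g, h] using MeasurePreserving.id _
  have hmp := measurePreserving_pi _ _ hg
  have hprod (θ : ι → ℝ) : ∏ i, 2 * Real.cos (g i (θ i)) = -∏ i, 2 * Real.cos (θ i) := by
    have (i : ι) : 2 * Real.cos (g i (θ i)) =
        (if i = j then -1 else 1) * (2 * Real.cos (θ i)) := by
      by_cases h : i = j <;> simp [g, h, cos_halfReflect]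
    simp_rw [this, Finset.prod_mul_distrib]
    simp
  have hm : Measurable fun θ : ι → ℝ => f (∏ i, 2 * Real.cos (θ i)) :=
    hf.comp (by fun_prop)
  rw [volume_pi, Measure.restrict_pi_pi]
  conv_rhs => rw [← hmp.map_eq]
  rw [integral_map hmp.measurable.aemeasurable hm.aestronglyMeasurable]
  simp_rw [hprod]

/-- For `r ≥ 1`, real `s > 0` and `0 ≤ k < 2^r`:
`conj(F_{r,s}(−k)) = e^{−iπs} · F_{r,s}(k)`. -/
theorem stmt19 (r : ℕ) (hr : 1 ≤ r) (s : ℝ) (hs : 0 < s)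
    (k : ℝ) (hk0 : 0 ≤ k) (hk : k < 2 ^ r) :
    (starRingEnd ℂ) (Frs r (s : ℂ) (-k)) =
      Complex.exp (-(Real.pi : ℂ) * Complex.I * (s : ℂ)) * Frs r (s : ℂ) k := by
  have : Nonempty (Fin r) := ⟨⟨0, hr⟩⟩
  have hf : Measurable fun p : ℝ => cpowP (((-k : ℝ) : ℂ) + (p : ℂ)) s :=
    (measurable_cpowP s).comp (by fun_prop)
  have hsymm := integral_cube_prod_cos_neg (ι := Fin r) hf
  push_cast at hsymm
  unfold Frs
  push_cast
  rw [← hsymm, map_mul, ← integral_conj, mul_left_comm]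
  refine congrArg₂ (· * ·) ?_ ?_
  · simp [Complex.conj_ofReal, map_ofNat (starRingEnd ℂ) 2]
  · rw [← integral_const_mul]
    congr 1
    ext θ
    have h := conj_cpowP_neg_ofReal (k + ∏ i, 2 * Real.cos (θ i)) s
    push_cast at h
    rw [← h, neg_add]
end
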